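/- arXiv:1310.5554 — 9 statements merged into one kernel-verified Lean document; each statement's English description precedes it below -/
import Mathlib

section
/- For all integers r ≥ 3 and s ≥ 4, let F = x² + y²z + y·t^r + z^s ∈ ℂ[x,y,z,t]. Then the ℂ-vector space dimension of ℂ[x,y,z,t]/J_F equals 2rs − s − 1; in particular, setting m = min(2r, s+1), it is at least m(m−2). (This is the quasihomogeneous Milnor number computation in case (a) of the proof of Lemma 1.2, bounding the Milnor number of a cD_m point from below.) -/
open MvPolynomial

/-- The Jacobian ideal of a multivariate polynomial: the ideal generated by all
first-order partial derivatives. -/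
noncomputable def jacobianIdeal {σ : Type*} [DecidableEq σ] (f : MvPolynomial σ ℂ) :
    Ideal (MvPolynomial σ ℂ) :=
  Ideal.span (Set.range fun i : σ => pderiv i f)

namespace MilnorCD

abbrev P := MvPolynomial (Fin 4) ℂ
abbrev W := (ℕ × ℕ × ℕ) →₀ ℂ

/-- The standard monomials `y^b z^c t^d`. -/
def good (r s : ℕ) (p : ℕ × ℕ × ℕ) : Prop :=
  (p.1 = 0 ∧ p.2.1 < s ∧ p.2.2 < r ∧ ¬ (p.2.1 + 1 = s ∧ p.2.2 + 1 = r)) ∨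
    (p.1 = 1 ∧ p.2.1 < s ∧ p.2.2 + 1 < r)

instance (r s : ℕ) (p : ℕ × ℕ × ℕ) : Decidable (good r s p) := by
  unfold good; infer_instance

noncomputable def e (r s b c d : ℕ) : W :=
  if good r s (b, c, d) then Finsupp.single (b, c, d) 1 else 0

/-- Normal form of the monomial `x^a y^b z^c t^d`. -/
noncomputable def nf (r s : ℕ) : ℕ → ℕ → ℕ → ℕ → W
  | 0, 0, c, d => if d < r then e r s 0 c d else (-2 : ℂ) • e r s 1 (c + 1) (d - r)
  | 0, 1, c, d => e r s 1 c d
  | 0, 2, c, d => (-(s : ℂ)) • e r s 0 (c + s - 1) d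
  | 0, 3, c, d => (-(s : ℂ)) • e r s 1 (c + s - 1) d
  | _, _, _, _ => 0

lemma e_zero {r s b c d : ℕ} (h : ¬ good r s (b, c, d)) : e r s b c d = 0 := if_neg h

noncomputable def phi (r s : ℕ) : P →ₗ[ℂ] W :=
  (basisMonomials (Fin 4) ℂ).constr ℂ (fun m => nf r s (m 0) (m 1) (m 2) (m 3))

noncomputable def mon (a b c d : ℕ) : P := X 0 ^ a * X 1 ^ b * X 2 ^ c * X 3 ^ d

lemma monomial_eq_mon (m : Fin 4 →₀ ℕ) :
    (monomial m (1 : ℂ)) = mon (m 0) (m 1) (m 2) (m 3) := by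
  rw [monomial_eq, Finsupp.prod_fintype _ _ (by simp), Fin.prod_univ_four]
  simp [mon]

lemma phi_mon (r s a b c d : ℕ) : phi r s (mon a b c d) = nf r s a b c d := by
  have h := monomial_eq_mon (Finsupp.equivFunOnFinite.symm ![a, b, c, d])
  simp at h
  rw [← h, phi]
  have := (basisMonomials (Fin 4) ℂ).constr_basis ℂ
    (fun m => nf r s (m 0) (m 1) (m 2) (m 3)) (Finsupp.equivFunOnFinite.symm ![a, b, c, d])
  simpa using this

lemma hom_ext {M : Type*} [AddCommGroup M] [Module ℂ M] (f g : P →ₗ[ℂ] M)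
    (h : ∀ a b c d, f (mon a b c d) = g (mon a b c d)) : f = g := by
  apply (basisMonomials (Fin 4) ℂ).ext
  intro m
  rw [coe_basisMonomials]
  simp only [monomial_eq_mon]
  exact h _ _ _ _

lemma nf_succ (r s a b c d : ℕ) : nf r s (a + 1) b c d = 0 := by
  unfold nf; rfl

lemma nf_four (r s a b c d : ℕ) : nf r s a (b + 4) c d = 0 := by
  cases a <;> simp [nf]

lemma rel1 (r s a b c d : ℕ) (hr : 3 ≤ r) (hs : 4 ≤ s) :
    (2 : ℂ) • nf r s a (b + 1) (c + 1) d + nf r s a b c (d + r) = 0 := by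
  rcases a with _ | a
  swap
  · simp [nf_succ]
  rcases b with _ | _ | _ | _ | b
  · simp [nf]
  · simp only [nf, Nat.zero_add]
    rw [e_zero, e_zero] <;> simp [good] <;> omega
  · simp only [nf, Nat.zero_add, Nat.reduceAdd]
    rw [e_zero, e_zero] <;> simp [good] <;> omega
  · simp only [nf, Nat.zero_add, Nat.reduceAdd]
    rw [e_zero] <;> simp [good] 
    omega
  · rw [show b + 1 + 1 + 1 + 1 + 1 = (b + 1) + 4 by omega,
      show b + 1 + 1 + 1 + 1 = b + 4 by omega, nf_four, nf_four]; simp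

lemma rel2 (r s a b c d : ℕ) (hr : 3 ≤ r) (hs : 4 ≤ s) :
    nf r s a (b + 2) c d + (s : ℂ) • nf r s a b (c + (s - 1)) d = 0 := by
  have hc : c + (s - 1) = c + s - 1 := by omega
  rcases a with _ | a
  swap
  · simp [nf_succ]
  rcases b with _ | _ | _ | _ | b
  · simp only [nf, Nat.zero_add, hc]
    split_ifs with h
    · simp
    · rw [e_zero, e_zero] <;> simp [good] <;> omega
  · simp [nf, hc]
  · simp only [nf, Nat.zero_add, Nat.reduceAdd]
    rw [e_zero] <;> simp [good]
    omega
  · simp only [nf, Nat.zero_add, Nat.reduceAdd]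
    rw [e_zero] <;> simp [good]
    omega
  · rw [show b + 1 + 1 + 1 + 1 + 2 = (b + 2) + 4 by omega,
      show b + 1 + 1 + 1 + 1 = b + 4 by omega, nf_four, nf_four]; simp

lemma rel3 (r s a b c d : ℕ) (hr : 3 ≤ r) (hs : 4 ≤ s) :
    nf r s a (b + 1) c (d + (r - 1)) = 0 := by
  rcases a with _ | a
  swap
  · simp [nf_succ]
  rcases b with _ | _ | _ | b
  · simp only [nf, Nat.zero_add]
    rw [e_zero]; simp [good]; omega
  · simp only [nf, Nat.zero_add, Nat.reduceAdd]
    rw [e_zero] <;> simp [good]; omega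
  · simp only [nf, Nat.zero_add, Nat.reduceAdd]
    rw [e_zero] <;> simp [good]; omega
  · rw [show b + 1 + 1 + 1 + 1 = b + 4 by omega, nf_four]

noncomputable abbrev F (r s : ℕ) : P :=
  (X 0 : MvPolynomial (Fin 4) ℂ) ^ 2 + (X 1) ^ 2 * X 2 + X 1 * (X 3) ^ r + (X 2) ^ s

noncomputable abbrev J (r s : ℕ) : Ideal P := jacobianIdeal (F r s)

lemma C_two : (C (2 : ℂ) : P) = 2 := map_ofNat C 2

lemma pd0 (r s : ℕ) : pderiv 0 (F r s) = (2 : ℂ) • X 0 := by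
  simp [F, pderiv_X, Derivation.leibniz_pow, smul_eq_C_mul, C_two]
lemma pd1 (r s : ℕ) : pderiv 1 (F r s) = (2 : ℂ) • (X 1 * X 2) + X 3 ^ r := by
  simp [F, pderiv_X, Derivation.leibniz_pow, Derivation.leibniz, smul_eq_C_mul, C_two]; ring
lemma pd2 (r s : ℕ) : pderiv 2 (F r s) = X 1 ^ 2 + (s : ℂ) • X 2 ^ (s - 1) := by
  simp [F, pderiv_X, Derivation.leibniz_pow, Derivation.leibniz, smul_eq_C_mul]
lemma pd3 (r s : ℕ) : pderiv 3 (F r s) = (r : ℂ) • (X 1 * X 3 ^ (r - 1)) := by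
  simp [F, pderiv_X, Derivation.leibniz_pow, Derivation.leibniz, smul_eq_C_mul]; ring

lemma mon_mul (a b c d a' b' c' d' : ℕ) :
    mon a b c d * mon a' b' c' d' = mon (a + a') (b + b') (c + c') (d + d') := by
  simp only [mon, pow_add]; ring

lemma pd0' (r s : ℕ) : pderiv 0 (F r s) = (2 : ℂ) • mon 1 0 0 0 := by
  rw [pd0]; simp [mon]
lemma pd1' (r s : ℕ) : pderiv 1 (F r s) = (2 : ℂ) • mon 0 1 1 0 + mon 0 0 0 r := by
  rw [pd1]; simp [mon]
lemma pd2' (r s : ℕ) : pderiv 2 (F r s) = mon 0 2 0 0 + (s : ℂ) • mon 0 0 (s - 1) 0 := by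
  rw [pd2]; simp [mon]
lemma pd3' (r s : ℕ) : pderiv 3 (F r s) = (r : ℂ) • mon 0 1 0 (r - 1) := by
  rw [pd3]; simp [mon]

lemma phi_mul_zero (r s : ℕ) (g : P) (h : ∀ a b c d, phi r s (mon a b c d * g) = 0) (p : P) :
    phi r s (p * g) = 0 := by
  have key : (phi r s) ∘ₗ (LinearMap.mulRight ℂ g) = 0 := by
    apply hom_ext
    intro a b c d
    simpa using h a b c d
  exact LinearMap.congr_fun key p

lemma phi_mul_pd (r s : ℕ) (hr : 3 ≤ r) (hs : 4 ≤ s) (i : Fin 4) (p : P) :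
    phi r s (p * pderiv i (F r s)) = 0 := by
  apply phi_mul_zero
  intro a b c d
  obtain rfl | rfl | rfl | rfl : i = 0 ∨ i = 1 ∨ i = 2 ∨ i = 3 := by omega
  · rw [pd0', mul_smul_comm, mon_mul, map_smul, phi_mon, nf_succ, smul_zero]
  · rw [pd1', mul_add, mul_smul_comm, mon_mul, mon_mul, map_add, map_smul, phi_mon, phi_mon]
    exact rel1 r s a b c d hr hs
  · rw [pd2', mul_add, mul_smul_comm, mon_mul, mon_mul, map_add, map_smul, phi_mon, phi_mon]
    exact rel2 r s a b c d hr hs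
  · rw [pd3', mul_smul_comm, mon_mul, map_smul, phi_mon]
    have := rel3 r s a b c d hr hs
    simp only [add_zero]
    rw [this, smul_zero]

lemma phi_J (r s : ℕ) (hr : 3 ≤ r) (hs : 4 ≤ s) (p : P) (hp : p ∈ J r s) :
    phi r s p = 0 := by
  unfold J jacobianIdeal at hp
  refine Submodule.span_induction (p := fun q _ => ∀ a : P, phi r s (a * q) = 0)
    ?_ ?_ ?_ ?_ hp 1 |> fun h => by simpa using h
  · rintro _ ⟨i, rfl⟩ a
    exact phi_mul_pd r s hr hs i a
  · simp
  · intro x y _ _ hx hy a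
    rw [mul_add, map_add, hx, hy, add_zero]
  · intro b x _ hx a
    rw [smul_eq_mul, ← mul_assoc]; exact hx _

abbrev A (r s : ℕ) := P ⧸ J r s

noncomputable def mu (r s : ℕ) : P →ₐ[ℂ] A r s := Ideal.Quotient.mkₐ ℂ (J r s)

lemma mu_pd (r s : ℕ) (i : Fin 4) : mu r s (pderiv i (F r s)) = 0 :=
  Ideal.Quotient.eq_zero_iff_mem.2 (Ideal.subset_span ⟨i, rfl⟩)

noncomputable def psi {B : Type*} [CommRing B] [Algebra ℂ B] (mu : P →ₐ[ℂ] B) : W →ₗ[ℂ] B :=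
  Finsupp.linearCombination ℂ (fun p => mu (mon 0 p.1 p.2.1 p.2.2))


lemma psi_e {B : Type*} [CommRing B] [Algebra ℂ B] (mu : P →ₐ[ℂ] B) (r s b c d : ℕ) (h : ¬ good r s (b, c, d) → mu (mon 0 b c d) = 0) :
    psi mu (e r s b c d) = mu (mon 0 b c d) := by
  unfold e
  split_ifs with hg
  · simp [psi]
  · rw [h hg, map_zero]

lemma psi_phi {B : Type*} [CommRing B] [Algebra ℂ B] (mu : P →ₐ[ℂ] B)
    (r s : ℕ) (mu_pd : ∀ i, mu (pderiv i (F r s)) = 0) (hr : 3 ≤ r) (hs : 4 ≤ s) :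
    psi mu ∘ₗ phi r s = mu.toLinearMap := by
  have hs0 : (s : ℂ) ≠ 0 := by exact_mod_cast (by omega : s ≠ 0)
  have hr0 : (r : ℂ) ≠ 0 := by exact_mod_cast (by omega : r ≠ 0)
  obtain ⟨r, rfl⟩ : ∃ k, r = k + 1 := ⟨r - 1, by omega⟩
  obtain ⟨s, rfl⟩ : ∃ k, s = k + 1 := ⟨s - 1, by omega⟩
  generalize hσ : ((s + 1 : ℕ) : ℂ) = σ at *
  have h0 := mu_pd 0
  have h1 := mu_pd 1
  have h2 := mu_pd 2
  have h3 := mu_pd 3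
  rw [pd0, map_smul, smul_eq_zero_iff_right (by norm_num)] at h0
  rw [pd1, map_add, map_smul, map_mul, map_pow] at h1
  rw [pd2, map_add, map_smul, map_pow, map_pow, hσ] at h2
  rw [pd3, map_smul, smul_eq_zero_iff_right hr0, map_mul, map_pow] at h3
  simp only [Nat.add_sub_cancel] at h2 h3
  have hm : ∀ a b c d, mu (mon a b c d) =
      mu (X 0) ^ a * mu (X 1) ^ b *
        mu (X 2) ^ c * mu (X 3) ^ d := by
    intro a b c d; simp [mon]
  have pe := psi_e mu (r + 1) (s + 1)
  simp only [hm, pow_zero, one_mul] at pe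
  rw [Algebra.smul_def] at h1 h2
  have hu : IsUnit (algebraMap ℂ B σ) :=
    (IsUnit.mk0 σ hs0).map _
  have hu2 : IsUnit (algebraMap ℂ B 2) :=
    (IsUnit.mk0 (2 : ℂ) two_ne_zero).map _
  apply hom_ext
  intro a b c d
  rw [LinearMap.comp_apply, phi_mon, AlgHom.toLinearMap_apply, hm]
  generalize mu (X 0) = x at *
  generalize mu (X 1) = y at *
  generalize mu (X 2) = z at *
  generalize mu (X 3) = t at *
  -- derived relations
  have hyt : ∀ k, y * t ^ (k + r) = 0 := by
    intro k; rw [pow_add]; linear_combination t ^ k * h3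
  have hzs : z ^ (s + 1) = 0 := by
    have : algebraMap ℂ B 2 * (algebraMap ℂ B σ *
        z ^ (s + 1)) = 0 := by
      linear_combination (-y) * h1 + algebraMap ℂ B 2 * z * h2 + t * h3
    rwa [hu2.mul_right_eq_zero, hu.mul_right_eq_zero] at this
  have hzt : z ^ s * t ^ r = 0 := by
    have : algebraMap ℂ B σ * (z ^ s * t ^ r) = 0 := by
      linear_combination t ^ r * h2 - y * h3
    rwa [hu.mul_right_eq_zero] at this
  have hz : ∀ c, s + 1 ≤ c → z ^ c = 0 := fun c hc => pow_eq_zero_of_le hc hzs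
  have hb1 : ∀ c d, psi mu (e (r + 1) (s + 1) 1 c d) = y ^ 1 * z ^ c * t ^ d := by
    intro c d
    apply pe
    intro hg
    simp [good] at hg
    by_cases hc : s + 1 ≤ c
    · rw [hz c hc]; ring
    · obtain ⟨k, rfl⟩ : ∃ k, d = k + r := ⟨d - r, by omega⟩
      linear_combination z ^ c * hyt k
  have hb0 : ∀ c d, (d < r + 1 ∨ s ≤ c) →
      psi mu (e (r + 1) (s + 1) 0 c d) = z ^ c * t ^ d := by
    intro c d hd
    have := pe 0 c d
    rw [pow_zero, one_mul] at this
    apply this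
    intro hg
    simp [good] at hg
    by_cases hc : s + 1 ≤ c
    · rw [hz c hc]; ring
    · obtain ⟨k, rfl⟩ : ∃ k, d = k + r := ⟨d - r, by omega⟩
      obtain rfl : c = s := by omega
      rw [pow_add]
      linear_combination t ^ k * hzt
  rcases a with _ | a
  swap
  · rw [nf_succ, h0]; simp
  rcases b with _ | _ | _ | _ | b
  · simp only [nf]
    split_ifs with h
    · rw [hb0 _ _ (Or.inl h)]; ring
    · obtain ⟨k, rfl⟩ : ∃ k, d = k + (r + 1) := ⟨d - (r + 1), by omega⟩
      rw [map_smul, hb1, Algebra.smul_def, Nat.add_sub_cancel, map_neg]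
      rw [pow_add t]
      linear_combination (-z ^ c * t ^ k) * h1
  · simp only [nf, Nat.zero_add]
    rw [hb1]; ring
  · simp only [nf, Nat.zero_add, Nat.reduceAdd]
    rw [map_smul, hb0 _ _ (Or.inr (by omega)), hσ, Algebra.smul_def, map_neg,
      show c + (s + 1) - 1 = c + s by omega, pow_add]
    linear_combination (-z ^ c * t ^ d) * h2
  · simp only [nf, Nat.zero_add, Nat.reduceAdd]
    rw [map_smul, hb1, hσ, Algebra.smul_def, map_neg,
      show c + (s + 1) - 1 = c + s by omega, pow_add]
    linear_combination (-z ^ c * t ^ d * y) * h2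
  · rw [show b + 1 + 1 + 1 + 1 = b + 4 by omega, nf_four, map_zero]
    have h4 : y ^ 4 = 0 := by
      have h5 := hz (s + s) (by omega)
      rw [pow_add] at h5
      linear_combination (y ^ 2 - algebraMap ℂ B σ * z ^ s) * h2
        + (algebraMap ℂ B σ) ^ 2 * h5
    rw [pow_add, h4]; ring

lemma range_phi (r s : ℕ) (hr : 3 ≤ r) (hs : 4 ≤ s) :
    LinearMap.range (phi r s) = Finsupp.supported ℂ ℂ {p | good r s p} := by
  have he : ∀ b c d, e r s b c d ∈ Finsupp.supported ℂ ℂ {p | good r s p} := by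
    intro b c d
    unfold e
    split_ifs with h
    · exact Finsupp.single_mem_supported ℂ _ h
    · exact Submodule.zero_mem _
  apply le_antisymm
  · rw [LinearMap.range_eq_map, ← (basisMonomials (Fin 4) ℂ).span_eq, Submodule.map_span,
      Submodule.span_le]
    rintro _ ⟨_, ⟨m, rfl⟩, rfl⟩
    rw [coe_basisMonomials]
    simp only [monomial_eq_mon, phi_mon]
    generalize m 0 = a
    generalize m 1 = b
    generalize m 2 = c
    generalize m 3 = d
    unfold nf
    split
    · split_ifs
      · exact he _ _ _
      · exact Submodule.smul_mem _ _ (he _ _ _)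
    · exact he _ _ _
    · exact Submodule.smul_mem _ _ (he _ _ _)
    · exact Submodule.smul_mem _ _ (he _ _ _)
    · exact Submodule.zero_mem _
  · rw [Finsupp.supported_eq_span_single, Submodule.span_le]
    rintro _ ⟨⟨b, c, d⟩, hg, rfl⟩
    refine ⟨mon 0 b c d, ?_⟩
    rw [phi_mon]
    have hg' : good r s (b, c, d) := hg
    rcases hg with ⟨h1, h2, h3, h4⟩ | ⟨h1, h2, h3⟩
    · simp only at h1 h2 h3
      subst h1
      simp [nf, h3, e, hg']
    · simp only at h1
      subst h1
      simp [nf, e, hg']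

lemma card_good (r s : ℕ) (hr : 3 ≤ r) (hs : 4 ≤ s) :
    Cardinal.mk {p | good r s p} = ((2 * r * s - s - 1 : ℕ) : Cardinal) := by
  have hS : {p | good r s p} = ((({0} ×ˢ ((Finset.range s ×ˢ Finset.range r).erase
      (s - 1, r - 1))) ∪ ({1} ×ˢ (Finset.range s ×ˢ Finset.range (r - 1))) :
      Finset (ℕ × ℕ × ℕ)) : Set (ℕ × ℕ × ℕ)) := by
    ext ⟨b, c, d⟩
    simp only [good, Set.mem_setOf_eq, Finset.mem_coe, Finset.mem_union, Finset.mem_product,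
      Finset.mem_erase, Finset.mem_range, Finset.mem_singleton, ne_eq, Prod.mk.injEq]
    omega
  rw [hS, Finset.coe_sort_coe, Cardinal.mk_coe_finset, Finset.card_union_of_disjoint]
  · rw [Finset.card_product, Finset.card_erase_of_mem]
    · simp only [Finset.card_product, Finset.card_range, Finset.card_singleton, one_mul]
      obtain ⟨r, rfl⟩ : ∃ k, r = k + 1 := ⟨r - 1, by omega⟩
      congr 1
      rw [Nat.add_sub_cancel, show 2 * (r + 1) * s = 2 * (s * r) + 2 * s by ring,
        show s * (r + 1) = s * r + s by ring]
      omega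
    · simp; omega
  · rw [Finset.disjoint_left]
    rintro ⟨b, c, d⟩ h h'
    simp at h h'
    omega

lemma rank_A (r s : ℕ) (hr : 3 ≤ r) (hs : 4 ≤ s) :
    Module.rank ℂ (A r s) = ((2 * r * s - s - 1 : ℕ) : Cardinal) := by
  have hk : LinearMap.ker (mu r s).toLinearMap = LinearMap.ker (phi r s) := by
    apply le_antisymm
    · intro p hp
      exact phi_J r s hr hs p (Ideal.Quotient.eq_zero_iff_mem.1 hp)
    · rw [← psi_phi (mu r s) r s (mu_pd r s) hr hs]
      exact LinearMap.ker_le_ker_comp _ _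
  have hsurj : Function.Surjective (mu r s).toLinearMap := Ideal.Quotient.mk_surjective
  have E := ((mu r s).toLinearMap.quotKerEquivOfSurjective hsurj).symm ≪≫ₗ
    Submodule.quotEquivOfEq _ _ hk ≪≫ₗ (phi r s).quotKerEquivRange ≪≫ₗ
    LinearEquiv.ofEq _ _ (range_phi r s hr hs) ≪≫ₗ Finsupp.supportedEquivFinsupp _
  rw [E.rank_eq, rank_finsupp_self', card_good r s hr hs]

end MilnorCD

/-- For `r ≥ 3` and `s ≥ 4`, the `ℂ`-dimension of `ℂ[x,y,z,t]/J_F` for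
`F = x² + y²z + y t^r + z^s` equals `2rs - s - 1`; in particular, setting
`m = min(2r, s+1)`, it is at least `m(m-2)`. -/
theorem milnor_number_cD_case_a (r s : ℕ) (hr : 3 ≤ r) (hs : 4 ≤ s) :
    Module.rank ℂ
        (MvPolynomial (Fin 4) ℂ ⧸
          jacobianIdeal ((X 0 : MvPolynomial (Fin 4) ℂ) ^ 2 + (X 1) ^ 2 * X 2 +
            X 1 * (X 3) ^ r + (X 2) ^ s)) =
        ((2 * r * s - s - 1 : ℕ) : Cardinal) ∧
      min (2 * r) (s + 1) * (min (2 * r) (s + 1) - 2) ≤ 2 * r * s - s - 1 := by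
  refine ⟨MilnorCD.rank_A r s hr hs, ?_⟩
  obtain ⟨k, hk⟩ : ∃ k, min (2 * r) (s + 1) = k + 2 := ⟨min (2 * r) (s + 1) - 2, by omega⟩
  have h1 : k + 2 ≤ 2 * r := by omega
  have h2 : k + 2 ≤ s + 1 := by omega
  rw [hk, Nat.add_sub_cancel]
  obtain ⟨q, hq⟩ : ∃ q, 2 * r = q + 1 := ⟨2 * r - 1, by omega⟩
  have h3 : (k + 1) * (k + 1) ≤ q * s := Nat.mul_le_mul (by omega) (by omega)
  rw [hq, show (q + 1) * s = q * s + s by ring]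
  have h4 : (k + 2) * k + 1 = (k + 1) * (k + 1) := by ring
  omega
end

section
/- For all integers s ≥ 4 and N ≥ s, let F = x² + y²z + z^s + t^N ∈ ℂ[x,y,z,t]. Then the ℂ-vector space dimension of ℂ[x,y,z,t]/J_F equals (s+1)(N−1); in particular it is at least (s+1)(s−1) = m(m−2) for m = s+1. (This is one of the quasihomogeneous Milnor number computations in case (b) of the proof of Lemma 1.2 for cD_{s+1} points.) -/
open MvPolynomial

namespace CDb

/-- coefficient functional of the normal form, on the `y, z` part -/
noncomputable def g (s b c i : ℕ) : ℂ :=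
  if i = s then (if b = 1 ∧ c = 0 then 1 else 0)
  else if b = 0 ∧ c = i then 1
  else if b = 2 ∧ c = 0 ∧ i + 1 = s then -(s : ℂ) else 0

/-- normal form map -/
noncomputable def phi (s N : ℕ) :
    MvPolynomial (Fin 4) ℂ →ₗ[ℂ] (Fin (s + 1) × Fin (N - 1) → ℂ) :=
  (basisMonomials (Fin 4) ℂ).constr ℂ
    (fun m k => if m 0 = 0 ∧ m 3 = (k.2 : ℕ) then g s (m 1) (m 2) k.1 else 0)

/-- the monomial with given exponents -/
noncomputable def mo (a b c d : ℕ) : MvPolynomial (Fin 4) ℂ :=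
  X 0 ^ a * X 1 ^ b * X 2 ^ c * X 3 ^ d

lemma monomial_eq_mo (m : Fin 4 →₀ ℕ) :
    monomial m (1 : ℂ) = mo (m 0) (m 1) (m 2) (m 3) := by
  rw [monomial_eq, Finsupp.prod_fintype _ _ (by simp)]
  simp [Fin.prod_univ_four, mo]

lemma exists_mo (a b c d : ℕ) : ∃ m : Fin 4 →₀ ℕ, mo a b c d = monomial m (1 : ℂ) ∧
    m 0 = a ∧ m 1 = b ∧ m 2 = c ∧ m 3 = d := by
  refine ⟨Finsupp.equivFunOnFinite.symm ![a, b, c, d], ?_, ?_, ?_, ?_, ?_⟩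
  · rw [monomial_eq_mo]; simp
  all_goals simp

lemma phi_mo (s N a b c d : ℕ) (k : Fin (s + 1) × Fin (N - 1)) :
    phi s N (mo a b c d) k = if a = 0 ∧ d = (k.2 : ℕ) then g s b c k.1 else 0 := by
  obtain ⟨m, hm, rfl, rfl, rfl, rfl⟩ := exists_mo a b c d
  have h : monomial m (1 : ℂ) = basisMonomials (Fin 4) ℂ m := by rw [coe_basisMonomials]
  rw [hm, phi, h, Module.Basis.constr_basis]

lemma lin_ext {M : Type*} [AddCommGroup M] [Module ℂ M]
    {f f' : MvPolynomial (Fin 4) ℂ →ₗ[ℂ] M}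
    (h : ∀ a b c d, f (mo a b c d) = f' (mo a b c d)) : f = f' := by
  refine (basisMonomials (Fin 4) ℂ).ext fun m => ?_
  have hm : basisMonomials (Fin 4) ℂ m = monomial m (1 : ℂ) := by rw [coe_basisMonomials]
  rw [hm, monomial_eq_mo]; exact h _ _ _ _

/-- the polynomial -/
noncomputable abbrev F (s N : ℕ) : MvPolynomial (Fin 4) ℂ :=
  (X 0 : MvPolynomial (Fin 4) ℂ) ^ 2 + (X 1) ^ 2 * X 2 + (X 2) ^ s + (X 3) ^ N

lemma C2 : (C 2 : MvPolynomial (Fin 4) ℂ) = 2 := map_ofNat C 2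

lemma d0 (s N : ℕ) : pderiv 0 (F s N) = (2 : ℂ) • X 0 := by
  simp [F, pderiv_X, Pi.single_apply, smul_eq_C_mul, C2]
lemma d1 (s N : ℕ) : pderiv 1 (F s N) = (2 : ℂ) • (X 1 * X 2) := by
  simp [F, pderiv_X, Pi.single_apply, smul_eq_C_mul, C2]; ring
lemma d2 (s N : ℕ) : pderiv 2 (F s N) = X 1 ^ 2 + (s : ℂ) • X 2 ^ (s - 1) := by
  simp [F, pderiv_X, Pi.single_apply, smul_eq_C_mul]
lemma d3 (s N : ℕ) : pderiv 3 (F s N) = (N : ℂ) • X 3 ^ (N - 1) := by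
  simp [F, pderiv_X, Pi.single_apply, smul_eq_C_mul]

lemma phi_gen (s N : ℕ) (hs : 4 ≤ s) (i : Fin 4) (q : MvPolynomial (Fin 4) ℂ) :
    phi s N (q * pderiv i (F s N)) = 0 := by
  suffices h : (phi s N).comp ((LinearMap.mulRight ℂ (pderiv i (F s N)))) = 0 from
    LinearMap.congr_fun h q
  apply lin_ext
  intro a b c d
  simp only [LinearMap.comp_apply, LinearMap.mulRight_apply, LinearMap.zero_apply]
  fin_cases i
  · change phi s N (mo a b c d * pderiv 0 (F s N)) = 0
    have : mo a b c d * pderiv 0 (F s N) = (2 : ℂ) • mo (a + 1) b c d := by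
      rw [d0, smul_eq_C_mul, smul_eq_C_mul]; simp only [mo]; ring
    rw [this, map_smul]; ext k; simp [phi_mo]
  · change phi s N (mo a b c d * pderiv 1 (F s N)) = 0
    have : mo a b c d * pderiv 1 (F s N) = (2 : ℂ) • mo a (b + 1) (c + 1) d := by
      rw [d1, smul_eq_C_mul, smul_eq_C_mul]; simp only [mo]; ring
    rw [this, map_smul]; ext k; simp [phi_mo, g]
  · change phi s N (mo a b c d * pderiv 2 (F s N)) = 0
    have : mo a b c d * pderiv 2 (F s N) =
        mo a (b + 2) c d + (s : ℂ) • mo a b (c + (s - 1)) d := by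
      rw [d2, smul_eq_C_mul, smul_eq_C_mul]; simp only [mo]; ring
    rw [this, map_add, map_smul]; ext ⟨⟨i, hi⟩, j⟩
    simp only [Pi.add_apply, Pi.smul_apply, phi_mo, Pi.zero_apply, smul_eq_mul, g]
    by_cases h : a = 0 ∧ d = (j : ℕ)
    · rw [if_pos h, if_pos h]
      by_cases h1 : i = s
      · have h2 : ¬ (b = 1 ∧ c + (s - 1) = 0) := by omega
        rw [if_pos h1, if_pos h1, if_neg h2, if_neg (by omega)]; simp
      · by_cases h3 : b = 0 ∧ c = 0 ∧ i + 1 = s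
        · obtain ⟨rfl, rfl, rfl⟩ := h3
          simp
        · have h4 : ¬ (b = 0 ∧ c + (s - 1) = i) := by omega
          have h5 : ¬ (b = 2 ∧ c + (s - 1) = 0 ∧ i + 1 = s) := by omega
          have h6 : ¬ (b + 2 = 2 ∧ c = 0 ∧ i + 1 = s) := by omega
          have h7 : ¬ (b + 2 = 0 ∧ c = i) := by omega
          rw [if_neg h1, if_neg h1, if_neg h7, if_neg h6, if_neg h4, if_neg h5]; simp
    · rw [if_neg h, if_neg h]; simp
  · change phi s N (mo a b c d * pderiv 3 (F s N)) = 0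
    have : mo a b c d * pderiv 3 (F s N) = (N : ℂ) • mo a b c (d + (N - 1)) := by
      rw [d3, smul_eq_C_mul, smul_eq_C_mul]; simp only [mo]; ring
    rw [this, map_smul]; ext ⟨i, ⟨j, hj⟩⟩
    have : ¬ (a = 0 ∧ d + (N - 1) = j) := by omega
    simp [phi_mo, this]

lemma phi_J (s N : ℕ) (hs : 4 ≤ s) (p : MvPolynomial (Fin 4) ℂ)
    (hp : p ∈ jacobianIdeal (F s N)) : phi s N p = 0 := by
  rw [jacobianIdeal] at hp
  induction hp using Submodule.span_induction with
  | mem x h => obtain ⟨i, rfl⟩ := h; simpa using phi_gen s N hs i 1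
  | zero => simp
  | add x y _ _ hx hy => rw [map_add, hx, hy, add_zero]
  | smul r x hx _ =>
    rw [smul_eq_mul]
    obtain ⟨c, rfl⟩ := (Ideal.mem_span_range_iff_exists_fun).1 hx
    rw [Finset.mul_sum, map_sum]
    refine Finset.sum_eq_zero fun i _ => ?_
    rw [← mul_assoc]; exact phi_gen s N hs i _

/-- basis monomials -/
noncomputable def bm (s N : ℕ) (k : Fin (s + 1) × Fin (N - 1)) : MvPolynomial (Fin 4) ℂ :=
  if (k.1 : ℕ) = s then mo 0 1 0 k.2 else mo 0 0 k.1 k.2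

lemma phi_bm (s N : ℕ) (k : Fin (s + 1) × Fin (N - 1)) :
    phi s N (bm s N k) = Pi.single k 1 := by
  obtain ⟨⟨i, hi⟩, ⟨j, hj⟩⟩ := k
  ext ⟨⟨i', hi'⟩, ⟨j', hj'⟩⟩
  rw [Pi.single_apply]
  simp only [bm, Prod.mk.injEq, Fin.mk.injEq]
  split_ifs with h1 h2 h2 <;> simp only [phi_mo, g] <;> grind

lemma main (s N : ℕ) (hs : 4 ≤ s) (hN : s ≤ N) :
    Module.rank ℂ (MvPolynomial (Fin 4) ℂ ⧸ jacobianIdeal (F s N)) =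
        (((s + 1) * (N - 1) : ℕ) : Cardinal) := by
  set J := jacobianIdeal (F s N) with hJ
  let r : MvPolynomial (Fin 4) ℂ →ₐ[ℂ] (MvPolynomial (Fin 4) ℂ ⧸ J) := Ideal.Quotient.mkₐ ℂ J
  have hr : ∀ p, p ∈ J → r p = 0 := fun p hp => Ideal.Quotient.eq_zero_iff_mem.2 hp
  let e : Fin (s + 1) × Fin (N - 1) → (MvPolynomial (Fin 4) ℂ ⧸ J) := fun k => r (bm s N k)
  have hli : LinearIndependent ℂ e := by
    let f : (MvPolynomial (Fin 4) ℂ ⧸ J) →ₗ[ℂ] (Fin (s + 1) × Fin (N - 1) → ℂ) :=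
      (J.restrictScalars ℂ).liftQ (phi s N) (fun p hp => phi_J s N hs p hp)
    apply LinearIndependent.of_comp f
    have : f ∘ e = Pi.basisFun ℂ _ := by
      ext1 k
      rw [Pi.basisFun_apply]
      exact phi_bm s N k
    rw [this]
    exact (Pi.basisFun ℂ _).linearIndependent
  have hd : ∀ i, r (pderiv i (F s N)) = 0 := fun i =>
    hr _ (Ideal.subset_span ⟨i, rfl⟩)
  have hs0 : (s : ℂ) ≠ 0 := by exact_mod_cast (by omega : s ≠ 0)
  have hN0 : (N : ℂ) ≠ 0 := by exact_mod_cast (by omega : N ≠ 0)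
  have hx : r (X 0) = 0 := by
    have := hd 0
    rw [d0, map_smul] at this
    exact (smul_eq_zero.1 this).resolve_left two_ne_zero
  have hyz : r (X 1) * r (X 2) = 0 := by
    have := hd 1
    rw [d1, map_smul, map_mul] at this
    exact (smul_eq_zero.1 this).resolve_left two_ne_zero
  have hy2 : r (X 1) ^ 2 = (-(s : ℂ)) • r (X 2) ^ (s - 1) := by
    have := hd 2
    rw [d2, map_add, map_smul, map_pow, map_pow] at this
    rw [neg_smul]; exact eq_neg_of_add_eq_zero_left this
  have ht : r (X 3) ^ (N - 1) = 0 := by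
    have := hd 3
    rw [d3, map_smul, map_pow] at this
    exact (smul_eq_zero.1 this).resolve_left hN0
  have hzs : r (X 2) ^ s = 0 := by
    have h1 : (-(s : ℂ)) • r (X 2) ^ s = 0 := by
      have : r (X 2) ^ s = r (X 2) ^ (s - 1) * r (X 2) := by
        rw [← pow_succ]; congr 1; omega
      rw [this, ← smul_mul_assoc, ← hy2, sq, mul_assoc, hyz, mul_zero]
    exact (smul_eq_zero.1 h1).resolve_left (neg_ne_zero.2 hs0)
  have hy3 : r (X 1) ^ 3 = 0 := by
    have : s - 1 = (s - 2) + 1 := by omega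
    rw [pow_succ, hy2, smul_mul_assoc, this, pow_succ, mul_assoc, mul_comm (r (X 2)), hyz]
    simp
  have hrmo : ∀ a b c d, r (mo a b c d) = r (X 0) ^ a * r (X 1) ^ b * r (X 2) ^ c * r (X 3) ^ d := by
    intro a b c d; simp [mo]
  have hspan : ∀ p, r p ∈ Submodule.span ℂ (Set.range e) := by
    intro p
    suffices h : ((Submodule.span ℂ (Set.range e)).mkQ).comp r.toLinearMap = 0 by
      have := LinearMap.congr_fun h p
      simpa using this
    apply lin_ext
    intro a b c d
    simp only [LinearMap.comp_apply, AlgHom.toLinearMap_apply, LinearMap.zero_apply,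
      Submodule.mkQ_apply, Submodule.Quotient.mk_eq_zero]
    have he : ∀ k, e k ∈ Submodule.span ℂ (Set.range e) := fun k =>
      Submodule.subset_span ⟨k, rfl⟩
    rcases Nat.eq_zero_or_pos a with rfl | ha
    swap
    · rw [hrmo, hx, zero_pow ha.ne']; simp
    by_cases hdN : d < N - 1
    swap
    · rw [hrmo, pow_eq_zero_of_le (not_lt.1 hdN) ht]; simp
    have hz : ∀ c, c < s → r (mo 0 0 c d) ∈ Submodule.span ℂ (Set.range e) := by
      intro c hc
      have := he (⟨c, by omega⟩, ⟨d, hdN⟩)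
      simpa [e, bm, hc.ne] using this
    by_cases hb0 : b = 0
    · subst hb0
      by_cases hc : c < s
      · exact hz c hc
      · rw [hrmo, pow_eq_zero_of_le (not_lt.1 hc) hzs]; simp
    by_cases hc : c = 0
    swap
    · obtain ⟨b, rfl⟩ := Nat.exists_eq_succ_of_ne_zero hb0
      obtain ⟨c, rfl⟩ := Nat.exists_eq_succ_of_ne_zero hc
      have : r (mo 0 (b + 1) (c + 1) d) = 0 := by
        rw [hrmo]
        linear_combination (r (X 1) ^ b * r (X 2) ^ c * r (X 3) ^ d) * hyz
      rw [Nat.succ_eq_add_one, Nat.succ_eq_add_one, this]; simp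
    subst hc
    by_cases hb1 : b = 1
    · subst hb1
      have := he (⟨s, by omega⟩, ⟨d, hdN⟩)
      simpa [e, bm] using this
    by_cases hb2 : b = 2
    · subst hb2
      have : r (mo 0 2 0 d) = (-(s : ℂ)) • r (mo 0 0 (s - 1) d) := by
        rw [hrmo, hrmo, hy2, pow_zero, pow_zero, pow_zero, one_mul, one_mul, mul_one, one_mul,
          smul_mul_assoc]
      rw [this]
      exact Submodule.smul_mem _ _ (hz _ (by omega))
    · rw [hrmo, pow_eq_zero_of_le (by omega : 3 ≤ b) hy3]; simp
  have hsp : ⊤ ≤ Submodule.span ℂ (Set.range e) := by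
    intro x _
    obtain ⟨p, rfl⟩ := Ideal.Quotient.mk_surjective x
    exact hspan p
  rw [rank_eq_card_basis (Module.Basis.mk hli hsp)]
  simp

end CDb

/-- For `s ≥ 4` and `N ≥ s`, the `ℂ`-dimension of `ℂ[x,y,z,t]/J_F` for
`F = x² + y²z + z^s + t^N` equals `(s+1)(N-1)`; in particular it is at
least `(s+1)(s-1)`. -/
theorem milnor_number_cD_case_b (s N : ℕ) (hs : 4 ≤ s) (hN : s ≤ N) :
    Module.rank ℂ
        (MvPolynomial (Fin 4) ℂ ⧸
          jacobianIdeal ((X 0 : MvPolynomial (Fin 4) ℂ) ^ 2 + (X 1) ^ 2 * X 2 +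
            (X 2) ^ s + (X 3) ^ N)) =
        (((s + 1) * (N - 1) : ℕ) : Cardinal) ∧
      (s + 1) * (s - 1) ≤ (s + 1) * (N - 1) := by
  exact ⟨CDb.main s N hs hN, Nat.mul_le_mul_left _ (by omega)⟩
end

section
/- Let i, j be natural numbers with i ≥ 1, 3 ≤ i+j ≤ 4 and (i,j) ≠ (4,0), and let F = (x₀x₁ − x₃²)² − (x₀x₂ − x₄²)² + x₀^{4−i−j}(x₁^i x₃^j + x₂^i x₄^j) + x₁⁴ + x₂⁴ ∈ ℂ[x₀,…,x₄]. Then for every nonzero v ∈ ℂ⁵, all five partial derivatives of F vanish at v if and only if v is a nonzero scalar multiple of e₀ = (1,0,0,0,0). Equivalently, the quartic hypersurface X^{i,j} = {F = 0} ⊂ ℙ⁴ has exactly one singular point, namely P = (1:0:0:0:0). -/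
open MvPolynomial

/-- The quartic `X^{i,j}`:
`(x₀x₁ − x₃²)² − (x₀x₂ − x₄²)² + x₀^{4−i−j}(x₁^i x₃^j + x₂^i x₄^j) + x₁⁴ + x₂⁴`. -/
noncomputable def quarticXij (i j : ℕ) : MvPolynomial (Fin 5) ℂ :=
  (X 0 * X 1 - (X 3) ^ 2) ^ 2 - (X 0 * X 2 - (X 4) ^ 2) ^ 2 +
    (X 0) ^ (4 - (i + j)) * ((X 1) ^ i * (X 3) ^ j + (X 2) ^ i * (X 4) ^ j) +
    (X 1) ^ 4 + (X 2) ^ 4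

/-! ## Univariate elimination
On the chart x₀ = 1 the critical equations decouple into a system in (x₁, x₃) and one in (x₂, x₄).
With x₃ = t·x₁ each of the non-monomial systems reduces to one polynomial equation for t, and then
the contribution of that pair to the remaining partial derivative ∂F/∂x₀ is a root of an explicit
integer polynomial, computed here as a minimal polynomial in ℚ[t]/(p). -/

lemma coreB21 (t b : ℂ) (hp : (1 - 8*t + 16*t^2 - 2*t^4 + 10*t^5) = 0) (hD : (4*t^3) * b = (-1 + 4*t)) :
    (1346875 + 2820416*(2*(b^2*(1-t^2*b))+t*b^3) + 2877440*(2*(b^2*(1-t^2*b))+t*b^3)^2 + 6701056*(2*(b^2*(1-t^2*b))+t*b^3)^3 + 9437184*(2*(b^2*(1-t^2*b))+t*b^3)^4 + 4194304*(2*(b^2*(1-t^2*b))+t*b^3)^5) = 0 := by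
  have hb : b = (-16 + 127/2*t + 1/2*t^2 + 2*t^3 + 40*t^4) := by
    linear_combination ((64 - 383/2*t + 3/2*t^2 + 4*t^3 - 120*t^4))*hD + (((1 + 8*t + 48*t^2))*(b) + (-48))*hp
  have hP : 2*(b^2*(1-t^2*b))+t*b^3 = (47/16 - 31/2*t - 5/16*t^2 - 9/8*t^3 - 10*t^4) := by
    rw [hb]
    linear_combination ((8145/16 - 4072*t + 388349/16*t^2 - 250987/8*t^3 + 1009/2*t^4 + 18432*t^5 - 40088*t^6 + 768*t^7 + 1920*t^8 - 12800*t^9))*hp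
  rw [hP]
  linear_combination ((1824369527 - 27433672232*t + 138178409980*t^2 - 228689235112*t^3 - 14910406782*t^4 + 155226065482*t^5 - 606376302868*t^6 - 28204129328*t^7 - 52643744896*t^8 - 605777044192*t^9 - 48019865920*t^10 - 111589643264*t^11 - 265147678720*t^12 - 18258329600*t^13 - 31981568000*t^14 - 41943040000*t^15))*hp

lemma coreC21 (t b : ℂ) (hp : (1 + 8*t + 16*t^2 + 2*t^4 + 10*t^5) = 0) (hD : (4*t^3) * b = (1 + 4*t)) :
    (-1353125 + 2891712*(2*(b^2*(1-t^2*b))-t*b^3) - 411648*(2*(b^2*(1-t^2*b))-t*b^3)^2 + 1884160*(2*(b^2*(1-t^2*b))-t*b^3)^3 - 7340032*(2*(b^2*(1-t^2*b))-t*b^3)^4 + 4194304*(2*(b^2*(1-t^2*b))-t*b^3)^5) = 0 := by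
  have hb : b = (-16 - 129/2*t - 1/2*t^2 + 2*t^3 - 40*t^4) := by
    linear_combination ((-64 - 385/2*t + 3/2*t^2 - 4*t^3 - 120*t^4))*hD + (((1 - 8*t + 48*t^2))*(b) + (-48))*hp
  have hP : 2*(b^2*(1-t^2*b))-t*b^3 = (-49/16 - 33/2*t - 5/16*t^2 + 9/8*t^3 - 10*t^4) := by
    rw [hb]
    linear_combination ((8241/16 + 4120*t + 398077/16*t^2 + 273515/8*t^3 - 1039/2*t^4 + 18432*t^5 + 41832*t^6 - 768*t^7 + 1920*t^8 + 12800*t^9))*hp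
  rw [hP]
  linear_combination ((-1843747049 - 30566803160*t - 172087941636*t^2 - 327490374616*t^3 - 18148906690*t^4 - 161901651702*t^5 - 773191093996*t^6 - 38572799024*t^7 + 76654103680*t^8 - 682911343328*t^9 - 53314518720*t^10 + 119935937536*t^11 - 271723233280*t^12 - 18258329600*t^13 + 31981568000*t^14 - 41943040000*t^15))*hp

lemma coreB13 (t b : ℂ) (hp : (32 + 9*t^2 + 20*t^3) = 0) (hD : (3*t + 4*t^2) * b = (4)) :
    (2700000 + 11644317*(b^2*(1-t^2*b)) + 102484980*(b^2*(1-t^2*b))^2 + 48035956*(b^2*(1-t^2*b))^3) = 0 := by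
  have hb : b = (48/229 - 1199/1832*t + 45/458*t^2) := by
    linear_combination ((12/229 - 1199/7328*t + 45/1832*t^2))*hD + (((1/32 - 9/1832*t))*(b) + 0)*hp
  have hP : b^2*(1-t^2*b) = (-14557725/24017978 + 6224808/12008989*t - 4856760/12008989*t^2) := by
    rw [hb]
    linear_combination ((15612957/768575296 - 2379915/96071912*t + 255911/12008989*t^2 - 43362729/6148602368*t^3 + 744795/768575296*t^4 - 18225/384287648*t^5))*hp
  rw [hP]
  linear_combination ((101837027518508476800/144215816802121 - 139344196307774531328/144215816802121*t + 98409466635186856320/144215816802121*t^2 - 22912365301799155200/144215816802121*t^3))*hp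

lemma coreC13 (t b : ℂ) (hp : (32 - 9*t^2 + 20*t^3) = 0) (hD : (-3*t + 4*t^2) * b = (4)) :
    (-2700000 + 11683683*(b^2*(1-t^2*b)) + 74304756*(b^2*(1-t^2*b))^2 + 90660748*(b^2*(1-t^2*b))^3) = 0 := by
  have hb : b = (-48/283 - 1361/2264*t + 45/566*t^2) := by
    linear_combination ((-12/283 - 1361/9056*t + 45/2264*t^2))*hD + (((1/32 - 9/2264*t))*(b) + 0)*hp
  have hP : b^2*(1-t^2*b) = (-11944989/45330374 - 3570600/22665187*t + 4681800/22665187*t^2) := by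
    rw [hb]
    linear_combination ((13249053/1450571968 + 2048139/181321496*t + 152231/22665187*t^2 - 45228969/11604575744*t^3 + 810405/1450571968*t^4 - 18225/725285984*t^5))*hp
  rw [hP]
  linear_combination ((-36571321860603120000/513710701744969 + 21725800676030880000/513710701744969*t - 37722987545537520000/513710701744969*t^2 + 20524310091086400000/513710701744969*t^3))*hp

lemma coreB31 (t b : ℂ) (hp : (1 + 32*t^2 + 28*t^3) = 0) (hD : (1 + 4*t^3) * b = (4*t)) :
    (823543 + 9209064*(b^2*(1-t^2*b)) + 27067520*(b^2*(1-t^2*b))^2 + 24017978*(b^2*(1-t^2*b))^3) = 0 := by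
  have hb : b = (24/229 + 898/229*t + 896/229*t^2) := by
    linear_combination ((449/458 + 32/229*t - 168/229*t^2))*hD + (((9/458 - 32/229*t + 24/229*t^2))*(b) + (-24/229))*hp
  have hP : b^2*(1-t^2*b) = (-5801216/12008989 + 2821192/12008989*t + 5431426/12008989*t^2) := by
    rw [hb]
    linear_combination ((5933120/12008989 + 7049624/12008989*t - 789742/12008989*t^2 - 24756608/12008989*t^3 - 47882240/12008989*t^4 - 25690112/12008989*t^5))*hp
  rw [hP]
  linear_combination ((-2333805375713679505/144215816802121 - 4324519058747366336/144215816802121*t + 4754265736127795888/144215816802121*t^2 + 11444941180744555484/144215816802121*t^3))*hp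

lemma coreC31 (t b : ℂ) (hp : (-1 + 32*t^2 + 28*t^3) = 0) (hD : (-1 + 4*t^3) * b = (4*t)) :
    (-823543 + 14828776*(b^2*(1-t^2*b)) - 49185920*(b^2*(1-t^2*b))^2 + 45330374*(b^2*(1-t^2*b))^3) = 0 := by
  have hb : b = (24/283 - 1150/283*t - 896/283*t^2) := by
    linear_combination ((-575/566 - 32/283*t + 168/283*t^2))*hD + (((9/566 + 32/283*t - 24/283*t^2))*(b) + (24/283))*hp
  have hP : b^2*(1-t^2*b) = (11846912/22665187 - 6138952/22665187*t - 13753474/22665187*t^2) := by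
    rw [hb]
    linear_combination ((11683904/22665187 + 9482648/22665187*t - 1950958/22665187*t^2 + 45400448/22665187*t^3 + 69558272/22665187*t^4 + 25690112/22665187*t^5))*hp
  rw [hP]
  linear_combination ((19149934129456878447/513710701744969 + 78519607936089824192/513710701744969*t - 36461564701394932400/513710701744969*t^2 - 185827163017843684316/513710701744969*t^3))*hp

lemma coreB30 (b : ℂ) (hp : (2 + 3*b + 4*b^2) = 0) :
    (48 + 11*(2*b^2+b^3) + 64*(2*b^2+b^3)^2) = 0 := by
  have hP : 2*b^2+b^3 = (-5/8 - 23/16*b) := by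
    linear_combination ((5/16 + 1/4*b))*hp
  rw [hP]
  linear_combination ((529/16))*hp

lemma coreC30 (b : ℂ) (hp : (-2 + 3*b + 4*b^2) = 0) :
    (80 - 299*(2*b^2-b^3) + 64*(2*b^2-b^3)^2) = 0 := by
  have hP : 2*b^2-b^3 = (11/8 - 41/16*b) := by
    linear_combination ((11/16 - 1/4*b))*hp
  rw [hP]
  linear_combination ((1681/16))*hp

/-! ## The two decoupled halves
For a critical pair either both coordinates vanish, or the value z is a root of one of the
listed polynomials. The letter B marks the pair (x₁, x₃), the letter C the pair (x₂, x₄). -/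

lemma halfB21 (b d z : ℂ) (hz : z = 2*b*(b-d^2)+b^2*d) (h1 : 2*(b-d^2)+2*b*d+4*b^3 = 0) (h2 : -4*(b-d^2)*d+b^2 = 0) :
    (b = 0 ∧ d = 0) ∨ (1346875 + 2820416*z + 2877440*z^2 + 6701056*z^3 + 9437184*z^4 + 4194304*z^5) = 0 := by
  subst hz
  by_cases hb0 : b = 0
  · left
    subst hb0
    refine ⟨rfl, ?_⟩
    by_contra hd
    exact hd (by simpa using h1)
  right
  obtain ⟨t, rfl⟩ : ∃ t, d = t * b := ⟨d / b, by field_simp⟩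
  have e2 : 4*t-4*t^3*b = 1 := by
    apply mul_left_cancel₀ (pow_ne_zero 2 hb0)
    linear_combination -h2
  have e1 : 1-t^2*b+t*b+2*b^2 = 0 := by
    apply mul_left_cancel₀ hb0
    linear_combination h1/2
  have := coreB21 t b (by linear_combination 8*t^6*e1 + (-2*t^5+2*t^4+4*t^3*b+4*t-1)*e2) (by linear_combination -e2)
  linear_combination this

lemma halfC21 (b d z : ℂ) (hz : z = 2*b*(b-d^2)-b^2*d) (h1 : -2*(b-d^2)+2*b*d+4*b^3 = 0) (h2 : 4*(b-d^2)*d+b^2 = 0) :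
    (b = 0 ∧ d = 0) ∨ (-1353125 + 2891712*z - 411648*z^2 + 1884160*z^3 - 7340032*z^4 + 4194304*z^5) = 0 := by
  subst hz
  by_cases hb0 : b = 0
  · left
    subst hb0
    refine ⟨rfl, ?_⟩
    by_contra hd
    exact hd (by simpa using h1)
  right
  obtain ⟨t, rfl⟩ : ∃ t, d = t * b := ⟨d / b, by field_simp⟩
  have e2 : 4*t-4*t^3*b = -1 := by
    apply mul_left_cancel₀ (pow_ne_zero 2 hb0)
    linear_combination h2
  have e1 : -1+t^2*b+t*b+2*b^2 = 0 := by
    apply mul_left_cancel₀ hb0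
    linear_combination h1/2
  have := coreC21 t b (by linear_combination 8*t^6*e1 + (2*t^5+2*t^4+4*t^3*b+4*t+1)*e2) (by linear_combination -e2)
  linear_combination this

lemma halfB13 (b d z : ℂ) (hz : z = b*(b-d^2)) (h1 : 2*(b-d^2)+d^3+4*b^3 = 0) (h2 : -4*(b-d^2)*d+3*b*d^2 = 0) :
    (b = 0 ∧ d = 0) ∨ (1 + 2*z) = 0 ∨ (2700000 + 11644317*z + 102484980*z^2 + 48035956*z^3) = 0 := by
  subst hz
  by_cases hb0 : b = 0
  · left
    subst hb0
    refine ⟨rfl, ?_⟩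
    by_contra hd
    exact hd (by simpa using h2)
  by_cases hd0 : d = 0
  · right; left
    subst hd0
    have e : 1*(1)+2*b^2 = 0 := by
      apply mul_left_cancel₀ hb0
      linear_combination h1/2
    linear_combination e
  right; right
  obtain ⟨t, rfl⟩ : ∃ t, d = t * b := ⟨d / b, by field_simp⟩
  have ht : t ≠ 0 := by
    rintro rfl
    simp at hd0
  have e2 : 4-4*t^2*b = (1)*3*t*b := by
    apply mul_left_cancel₀ (mul_ne_zero ht (pow_ne_zero 2 hb0))
    linear_combination (-1)*h2
  have e1 : (1)*2-(1)*2*t^2*b+(t^3+4)*b^2 = 0 := by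
    apply mul_left_cancel₀ hb0
    linear_combination h1
  have := coreB13 t b (by linear_combination (((4*t^2+(3)*t)^2*e1 + (-2*(1)*t^2*(4*t^2+(3)*t)+(t^3+4)*(4+(4*t^2+(3)*t)*b))*e2)/2)) (by linear_combination -e2)
  linear_combination this

lemma halfB31 (b d z : ℂ) (hz : z = b*(b-d^2)) (h1 : 2*(b-d^2)+3*b^2*d+4*b^3 = 0) (h2 : -4*(b-d^2)*d+b^3 = 0) :
    (b = 0 ∧ d = 0) ∨ (823543 + 9209064*z + 27067520*z^2 + 24017978*z^3) = 0 := by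
  subst hz
  by_cases hb0 : b = 0
  · left
    subst hb0
    refine ⟨rfl, ?_⟩
    by_contra hd
    exact hd (by simpa using h1)
  right
  obtain ⟨t, rfl⟩ : ∃ t, d = t * b := ⟨d / b, by field_simp⟩
  have e2 : 4*t-4*t^3*b = (1)*b := by
    apply mul_left_cancel₀ (pow_ne_zero 2 hb0)
    linear_combination (-1)*h2
  have e1 : (1)*2-(1)*2*t^2*b+(3*t+4)*b^2 = 0 := by
    apply mul_left_cancel₀ hb0
    linear_combination h1
  have e3 : 1+(6*t^2+8*t)*b = 0 := by
    apply mul_left_cancel₀ hb0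
    linear_combination 2*t*e1 - (1)*e2
  have := coreB31 t b (by linear_combination (4*t^3+(1))*e3 + (6*t^2+8*t)*e2) (by linear_combination -e2)
  linear_combination this

lemma halfB30 (b d z : ℂ) (hz : z = 2*b*(b-d^2)+b^3) (h1 : 2*(b-d^2)+3*b^2+4*b^3 = 0) (h2 : (b-d^2)*d = 0) :
    (b = 0 ∧ d = 0) ∨ (27 + 64*z) = 0 ∨ (48 + 11*z + 64*z^2) = 0 := by
  subst hz
  by_cases hb0 : b = 0
  · left
    subst hb0
    refine ⟨rfl, ?_⟩
    by_contra hd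
    exact hd (by simpa using h1)
  right
  rcases mul_eq_zero.mp h2 with h | h
  · left
    have e : 3+4*b = 0 := by
      apply mul_left_cancel₀ (pow_ne_zero 2 hb0)
      linear_combination h1 - (2)*h
    have e' : b = -3/4 := by linear_combination e/4
    rw [h, e']
    norm_num
  · right
    subst h
    have := coreB30 b (by
      apply mul_left_cancel₀ hb0
      linear_combination h1)
    linear_combination this

lemma halfC13 (b d z : ℂ) (hz : z = b*(b-d^2)) (h1 : -2*(b-d^2)+d^3+4*b^3 = 0) (h2 : 4*(b-d^2)*d+3*b*d^2 = 0) :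
    (b = 0 ∧ d = 0) ∨ (-1 + 2*z) = 0 ∨ (-2700000 + 11683683*z + 74304756*z^2 + 90660748*z^3) = 0 := by
  subst hz
  by_cases hb0 : b = 0
  · left
    subst hb0
    refine ⟨rfl, ?_⟩
    by_contra hd
    exact hd (by simpa using h2)
  by_cases hd0 : d = 0
  · right; left
    subst hd0
    have e : 1*(-1)+2*b^2 = 0 := by
      apply mul_left_cancel₀ hb0
      linear_combination h1/2
    linear_combination e
  right; right
  obtain ⟨t, rfl⟩ : ∃ t, d = t * b := ⟨d / b, by field_simp⟩
  have ht : t ≠ 0 := by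
    rintro rfl
    simp at hd0
  have e2 : 4-4*t^2*b = (-1)*3*t*b := by
    apply mul_left_cancel₀ (mul_ne_zero ht (pow_ne_zero 2 hb0))
    linear_combination (1)*h2
  have e1 : (-1)*2-(-1)*2*t^2*b+(t^3+4)*b^2 = 0 := by
    apply mul_left_cancel₀ hb0
    linear_combination h1
  have := coreC13 t b (by linear_combination (((4*t^2+(-3)*t)^2*e1 + (-2*(-1)*t^2*(4*t^2+(-3)*t)+(t^3+4)*(4+(4*t^2+(-3)*t)*b))*e2)/2)) (by linear_combination -e2)
  linear_combination this

lemma halfC31 (b d z : ℂ) (hz : z = b*(b-d^2)) (h1 : -2*(b-d^2)+3*b^2*d+4*b^3 = 0) (h2 : 4*(b-d^2)*d+b^3 = 0) :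
    (b = 0 ∧ d = 0) ∨ (-823543 + 14828776*z - 49185920*z^2 + 45330374*z^3) = 0 := by
  subst hz
  by_cases hb0 : b = 0
  · left
    subst hb0
    refine ⟨rfl, ?_⟩
    by_contra hd
    exact hd (by simpa using h1)
  right
  obtain ⟨t, rfl⟩ : ∃ t, d = t * b := ⟨d / b, by field_simp⟩
  have e2 : 4*t-4*t^3*b = (-1)*b := by
    apply mul_left_cancel₀ (pow_ne_zero 2 hb0)
    linear_combination (1)*h2
  have e1 : (-1)*2-(-1)*2*t^2*b+(3*t+4)*b^2 = 0 := by
    apply mul_left_cancel₀ hb0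
    linear_combination h1
  have e3 : 1+(6*t^2+8*t)*b = 0 := by
    apply mul_left_cancel₀ hb0
    linear_combination 2*t*e1 - (-1)*e2
  have := coreC31 t b (by linear_combination (4*t^3+(-1))*e3 + (6*t^2+8*t)*e2) (by linear_combination -e2)
  linear_combination this

lemma halfC30 (b d z : ℂ) (hz : z = 2*b*(b-d^2)-b^3) (h1 : -2*(b-d^2)+3*b^2+4*b^3 = 0) (h2 : (b-d^2)*d = 0) :
    (b = 0 ∧ d = 0) ∨ (-27 + 64*z) = 0 ∨ (80 - 299*z + 64*z^2) = 0 := by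
  subst hz
  by_cases hb0 : b = 0
  · left
    subst hb0
    refine ⟨rfl, ?_⟩
    by_contra hd
    exact hd (by simpa using h1)
  right
  rcases mul_eq_zero.mp h2 with h | h
  · left
    have e : 3+4*b = 0 := by
      apply mul_left_cancel₀ (pow_ne_zero 2 hb0)
      linear_combination h1 - (-2)*h
    have e' : b = -3/4 := by linear_combination e/4
    rw [h, e']
    norm_num
  · right
    subst h
    have := coreC30 b (by
      apply mul_left_cancel₀ hb0
      linear_combination h1)
    linear_combination this

lemma halfB12 (b d z : ℂ) (hz : z = 2*b*(b-d^2)+b*d^2) (h1 : 2*(b-d^2)+d^2+4*b^3 = 0) (h2 : -4*(b-d^2)*d+2*b*d = 0) :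
    (b = 0 ∧ d = 0) ∨ (1 + z) = 0 ∨ (9 + 16*z) = 0 := by
  subst hz
  by_cases hb0 : b = 0
  · left
    subst hb0
    refine ⟨rfl, ?_⟩
    by_contra hd
    exact hd (by simpa using h2)
  right
  by_cases hd0 : d = 0
  · left
    subst hd0
    have e : 1+2*b^2 = 0 := by
      apply mul_left_cancel₀ hb0
      linear_combination h1/2
    linear_combination e
  · right
    have e2 : 2*d^2 = b := by
      apply mul_left_cancel₀ hd0
      linear_combination h2/2
    have e1 : 3+8*b^2 = 0 := by
      apply mul_left_cancel₀ hb0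
      linear_combination 2*h1+e2
    linear_combination 3*e1 - 8*b*e2

lemma halfC12 (b d z : ℂ) (hz : z = 2*b*(b-d^2)-b*d^2) (h1 : -2*(b-d^2)+d^2+4*b^3 = 0) (h2 : 4*(b-d^2)*d+2*b*d = 0) :
    (b = 0 ∧ d = 0) ∨ (-1 + z) = 0 ∨ (-25 + 16*z) = 0 := by
  subst hz
  by_cases hb0 : b = 0
  · left
    subst hb0
    refine ⟨rfl, ?_⟩
    by_contra hd
    exact hd (by simpa using h2)
  right
  by_cases hd0 : d = 0
  · left
    subst hd0
    have e : -1+2*b^2 = 0 := by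
      apply mul_left_cancel₀ hb0
      linear_combination h1/2
    linear_combination e
  · right
    have e2 : 2*d^2 = 3*b := by
      apply mul_left_cancel₀ hd0
      linear_combination -h2/2
    have e1 : 5+8*b^2 = 0 := by
      apply mul_left_cancel₀ hb0
      linear_combination 2*h1-3*e2
    linear_combination -5*e1 - 24*b*e2

lemma halfB22 (b d z : ℂ) (hz : z = b*(b-d^2)) (h1 : 2*(b-d^2)+2*b*d^2+4*b^3 = 0) (h2 : -4*(b-d^2)*d+2*b^2*d = 0) :
    (b = 0 ∧ d = 0) ∨ (1 + 2*z) = 0 := by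
  subst hz
  by_cases hb0 : b = 0
  · left
    subst hb0
    refine ⟨rfl, ?_⟩
    by_contra hd
    exact hd (by simpa using h1)
  right
  by_cases hd0 : d = 0
  · subst hd0
    have e : 1+2*b^2 = 0 := by
      apply mul_left_cancel₀ hb0
      linear_combination h1/2
    linear_combination e
  · have e2 : b^2 = 2*(b-d^2) := by
      apply mul_left_cancel₀ hd0
      linear_combination h2/2
    have e1 : b = -1 := by
      apply mul_left_cancel₀ (pow_ne_zero 2 hb0)
      linear_combination (h1+(1-b)*e2)/3
    subst e1
    linear_combination e2

lemma halfC22 (b d z : ℂ) (hz : z = b*(b-d^2)) (h1 : -2*(b-d^2)+2*b*d^2+4*b^3 = 0) (h2 : 4*(b-d^2)*d+2*b^2*d = 0) :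
    (b = 0 ∧ d = 0) ∨ (-1 + 2*z) = 0 ∨ (-27 + 250*z) = 0 := by
  subst hz
  by_cases hb0 : b = 0
  · left
    subst hb0
    refine ⟨rfl, ?_⟩
    by_contra hd
    exact hd (by simpa using h1)
  right
  by_cases hd0 : d = 0
  · left
    subst hd0
    have e : -1+2*b^2 = 0 := by
      apply mul_left_cancel₀ hb0
      linear_combination h1/2
    linear_combination e
  · right
    have e2 : b^2 = -2*(b-d^2) := by
      apply mul_left_cancel₀ hd0
      linear_combination h2/2
    have e1 : b = -3/5 := by
      apply mul_left_cancel₀ (pow_ne_zero 2 hb0)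
      linear_combination (h1+(1+b)*e2)/5
    subst e1
    linear_combination -75*e2

/-! ## Combination of the halves
The vanishing of ∂F/∂x₀ says that both halves share the same value z. The candidate polynomials of
the two halves are pairwise coprime (Bézout certificates below), so only the origin survives. -/

lemma comb12 (b c d e : ℂ) (h0 : (2*b*(b-d^2)+b^1*d^2) = (2*c*(c-e^2)-c^1*e^2))
    (h1 : 2*(b-d^2)+1*b^0*d^2+4*b^3 = 0) (h2 : -4*(b-d^2)*d+2*b^1*d^1 = 0) (h3 : -2*(c-e^2)+1*c^0*e^2+4*c^3 = 0) (h4 : 4*(c-e^2)*e+2*c^1*e^1 = 0) :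
    b = 0 ∧ c = 0 ∧ d = 0 ∧ e = 0 := by
  obtain ⟨z, hz⟩ : ∃ z, z = (2*b*(b-d^2)+b^1*d^2) := ⟨_, rfl⟩
  have HB := halfB12 b d z (by linear_combination hz) (by linear_combination h1) (by linear_combination h2)
  have HC := halfC12 c e z (by linear_combination hz + h0) (by linear_combination h3) (by linear_combination h4)
  rcases HB with ⟨hb, hd⟩ | hB | hB <;> rcases HC with ⟨hc, he⟩ | hC | hC
  · exact ⟨hb, hc, hd, he⟩
  · rw [hb, hd] at hz
    exact absurd (by linear_combination (1)*hz + (-1)*hC) (one_ne_zero (α := ℂ))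
  · rw [hb, hd] at hz
    exact absurd (by linear_combination (16/25)*hz + (-1/25)*hC) (one_ne_zero (α := ℂ))
  · rw [h0, hc, he] at hz
    exact absurd (by linear_combination (1)*hB + (-1)*hz) (one_ne_zero (α := ℂ))
  · exact absurd (by linear_combination (1/2)*hB + (-1/2)*hC) (one_ne_zero (α := ℂ))
  · exact absurd (by linear_combination (16/41)*hB + (-1/41)*hC) (one_ne_zero (α := ℂ))
  · rw [h0, hc, he] at hz
    exact absurd (by linear_combination (1/9)*hB + (-16/9)*hz) (one_ne_zero (α := ℂ))
  · exact absurd (by linear_combination (1/25)*hB + (-16/25)*hC) (one_ne_zero (α := ℂ))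
  · exact absurd (by linear_combination (1/34)*hB + (-1/34)*hC) (one_ne_zero (α := ℂ))

lemma comb21 (b c d e : ℂ) (h0 : (2*b*(b-d^2)+b^2*d^1) = (2*c*(c-e^2)-c^2*e^1))
    (h1 : 2*(b-d^2)+2*b^1*d^1+4*b^3 = 0) (h2 : -4*(b-d^2)*d+1*b^2*d^0 = 0) (h3 : -2*(c-e^2)+2*c^1*e^1+4*c^3 = 0) (h4 : 4*(c-e^2)*e+1*c^2*e^0 = 0) :
    b = 0 ∧ c = 0 ∧ d = 0 ∧ e = 0 := by
  obtain ⟨z, hz⟩ : ∃ z, z = (2*b*(b-d^2)+b^2*d^1) := ⟨_, rfl⟩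
  have HB := halfB21 b d z (by linear_combination hz) (by linear_combination h1) (by linear_combination h2)
  have HC := halfC21 c e z (by linear_combination hz + h0) (by linear_combination h3) (by linear_combination h4)
  rcases HB with ⟨hb, hd⟩ | hB <;> rcases HC with ⟨hc, he⟩ | hC
  · exact ⟨hb, hc, hd, he⟩
  · rw [hb, hd] at hz
    exact absurd (by linear_combination (2891712/1353125 - 411648/1353125*z + 376832/270625*z^2 - 7340032/1353125*z^3 + 4194304/1353125*z^4)*hz + (-1/1353125)*hC) (one_ne_zero (α := ℂ))
  · rw [h0, hc, he] at hz
    exact absurd (by linear_combination (1/1346875)*hB + (-2820416/1346875 - 575488/269375*z - 6701056/1346875*z^2 - 9437184/1346875*z^3 - 4194304/1346875*z^4)*hz) (one_ne_zero (α := ℂ))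
  · exact absurd (by linear_combination (11002513559287240810062991/32679464966108524674500924609375 - 13762030122029558021090864/32679464966108524674500924609375*z + 3537508582436287189723776/6535892993221704934900184921875*z^2 - 29548828477083976010981376/32679464966108524674500924609375*z^3 + 15306156716409882067075072/32679464966108524674500924609375*z^4)*hB + (-13199412113399369761439138/32679464966108524674500924609375 - 3794618743876611061755984/6535892993221704934900184921875*z - 24213490372716680310625408/32679464966108524674500924609375*z^2 - 31675798388555552257318912/32679464966108524674500924609375*z^3 - 15306156716409882067075072/32679464966108524674500924609375*z^4)*hC) (one_ne_zero (α := ℂ))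

lemma comb30 (b c d e : ℂ) (h0 : (2*b*(b-d^2)+b^3*d^0) = (2*c*(c-e^2)-c^3*e^0))
    (h1 : 2*(b-d^2)+3*b^2*d^0+4*b^3 = 0) (h2 : -4*(b-d^2)*d+0*b^3*d^0 = 0) (h3 : -2*(c-e^2)+3*c^2*e^0+4*c^3 = 0) (h4 : 4*(c-e^2)*e+0*c^3*e^0 = 0) :
    b = 0 ∧ c = 0 ∧ d = 0 ∧ e = 0 := by
  obtain ⟨z, hz⟩ : ∃ z, z = (2*b*(b-d^2)+b^3*d^0) := ⟨_, rfl⟩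
  have HB := halfB30 b d z (by linear_combination hz) (by linear_combination h1) (by linear_combination h2/(-4))
  have HC := halfC30 c e z (by linear_combination hz + h0) (by linear_combination h3) (by linear_combination h4/4)
  rcases HB with ⟨hb, hd⟩ | hB | hB <;> rcases HC with ⟨hc, he⟩ | hC | hC
  · exact ⟨hb, hc, hd, he⟩
  · rw [hb, hd] at hz
    exact absurd (by linear_combination (64/27)*hz + (-1/27)*hC) (one_ne_zero (α := ℂ))
  · rw [hb, hd] at hz
    exact absurd (by linear_combination (299/80 - 4/5*z)*hz + (1/80)*hC) (one_ne_zero (α := ℂ))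
  · rw [h0, hc, he] at hz
    exact absurd (by linear_combination (1/27)*hB + (-64/27)*hz) (one_ne_zero (α := ℂ))
  · exact absurd (by linear_combination (1/54)*hB + (-1/54)*hC) (one_ne_zero (α := ℂ))
  · exact absurd (by linear_combination (163/6961 - 32/6961*z)*hB + (32/6961)*hC) (one_ne_zero (α := ℂ))
  · rw [h0, hc, he] at hz
    exact absurd (by linear_combination (1/48)*hB + (-11/48 - 4/3*z)*hz) (one_ne_zero (α := ℂ))
  · exact absurd (by linear_combination (32/2049)*hB + (-19/2049 - 32/2049*z)*hC) (one_ne_zero (α := ℂ))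
  · exact absurd (by linear_combination (45321/2393728 - 155/37402*z)*hB + (2729/2393728 + 155/37402*z)*hC) (one_ne_zero (α := ℂ))

lemma comb13 (b c d e : ℂ) (h0 : b*(b-d^2) = c*(c-e^2))
    (h1 : 2*(b-d^2)+1*b^0*d^3+4*b^3 = 0) (h2 : -4*(b-d^2)*d+3*b^1*d^2 = 0) (h3 : -2*(c-e^2)+1*c^0*e^3+4*c^3 = 0) (h4 : 4*(c-e^2)*e+3*c^1*e^2 = 0) :
    b = 0 ∧ c = 0 ∧ d = 0 ∧ e = 0 := by
  obtain ⟨z, hz⟩ : ∃ z, z = b*(b-d^2) := ⟨_, rfl⟩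
  have HB := halfB13 b d z (by linear_combination hz) (by linear_combination h1) (by linear_combination h2)
  have HC := halfC13 c e z (by linear_combination hz + h0) (by linear_combination h3) (by linear_combination h4)
  rcases HB with ⟨hb, hd⟩ | hB | hB <;> rcases HC with ⟨hc, he⟩ | hC | hC
  · exact ⟨hb, hc, hd, he⟩
  · rw [hb, hd] at hz
    exact absurd (by linear_combination (2)*hz + (-1)*hC) (one_ne_zero (α := ℂ))
  · rw [hb, hd] at hz
    exact absurd (by linear_combination (432729/100000 + 688007/25000*z + 22665187/675000*z^2)*hz + (-1/2700000)*hC) (one_ne_zero (α := ℂ))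
  · rw [h0, hc, he] at hz
    exact absurd (by linear_combination (1)*hB + (-2)*hz) (one_ne_zero (α := ℂ))
  · exact absurd (by linear_combination (1/2)*hB + (-1/2)*hC) (one_ne_zero (α := ℂ))
  · exact absurd (by linear_combination (-700877/649123 + 14487191/1298246*z + 22665187/649123*z^2)*hB + (-1/1298246)*hC) (one_ne_zero (α := ℂ))
  · rw [h0, hc, he] at hz
    exact absurd (by linear_combination (1/2700000)*hB + (-431271/100000 - 189787/5000*z - 12008989/675000*z^2)*hz) (one_ne_zero (α := ℂ))
  · exact absurd (by linear_combination (1/40147898)*hB + (-18723949/20073949 - 63251479/40147898*z - 12008989/20073949*z^2)*hC) (one_ne_zero (α := ℂ))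
  · exact absurd (by linear_combination (906953302903970115647688953229067/6071393286601682639047614960134400000000 + 11461698254082615481752047581743/56216604505571135546737175556800000000*z + 10758626862707177234468745169/56216604505571135546737175556800000000*z^2)*hB + (-1341710877318875306221798069042933/6071393286601682639047614960134400000000 - 1216077910935726841437701484963/11243320901114227109347435111360000000*z - 5700382337430306735602295343/56216604505571135546737175556800000000*z^2)*hC) (one_ne_zero (α := ℂ))

lemma comb22 (b c d e : ℂ) (h0 : b*(b-d^2) = c*(c-e^2))
    (h1 : 2*(b-d^2)+2*b^1*d^2+4*b^3 = 0) (h2 : -4*(b-d^2)*d+2*b^2*d^1 = 0) (h3 : -2*(c-e^2)+2*c^1*e^2+4*c^3 = 0) (h4 : 4*(c-e^2)*e+2*c^2*e^1 = 0) :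
    b = 0 ∧ c = 0 ∧ d = 0 ∧ e = 0 := by
  obtain ⟨z, hz⟩ : ∃ z, z = b*(b-d^2) := ⟨_, rfl⟩
  have HB := halfB22 b d z (by linear_combination hz) (by linear_combination h1) (by linear_combination h2)
  have HC := halfC22 c e z (by linear_combination hz + h0) (by linear_combination h3) (by linear_combination h4)
  rcases HB with ⟨hb, hd⟩ | hB <;> rcases HC with ⟨hc, he⟩ | hC | hC
  · exact ⟨hb, hc, hd, he⟩
  · rw [hb, hd] at hz
    exact absurd (by linear_combination (2)*hz + (-1)*hC) (one_ne_zero (α := ℂ))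
  · rw [hb, hd] at hz
    exact absurd (by linear_combination (250/27)*hz + (-1/27)*hC) (one_ne_zero (α := ℂ))
  · rw [h0, hc, he] at hz
    exact absurd (by linear_combination (1)*hB + (-2)*hz) (one_ne_zero (α := ℂ))
  · exact absurd (by linear_combination (1/2)*hB + (-1/2)*hC) (one_ne_zero (α := ℂ))
  · exact absurd (by linear_combination (125/152)*hB + (-1/152)*hC) (one_ne_zero (α := ℂ))

lemma comb31 (b c d e : ℂ) (h0 : b*(b-d^2) = c*(c-e^2))
    (h1 : 2*(b-d^2)+3*b^2*d^1+4*b^3 = 0) (h2 : -4*(b-d^2)*d+1*b^3*d^0 = 0) (h3 : -2*(c-e^2)+3*c^2*e^1+4*c^3 = 0) (h4 : 4*(c-e^2)*e+1*c^3*e^0 = 0) :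
    b = 0 ∧ c = 0 ∧ d = 0 ∧ e = 0 := by
  obtain ⟨z, hz⟩ : ∃ z, z = b*(b-d^2) := ⟨_, rfl⟩
  have HB := halfB31 b d z (by linear_combination hz) (by linear_combination h1) (by linear_combination h2)
  have HC := halfC31 c e z (by linear_combination hz + h0) (by linear_combination h3) (by linear_combination h4)
  rcases HB with ⟨hb, hd⟩ | hB <;> rcases HC with ⟨hc, he⟩ | hC
  · exact ⟨hb, hc, hd, he⟩
  · rw [hb, hd] at hz
    exact absurd (by linear_combination (14828776/823543 - 7026560/117649*z + 45330374/823543*z^2)*hz + (-1/823543)*hC) (one_ne_zero (α := ℂ))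
  · rw [h0, hc, he] at hz
    exact absurd (by linear_combination (1/823543)*hB + (-9209064/823543 - 27067520/823543*z - 24017978/823543*z^2)*hz) (one_ne_zero (α := ℂ))
  · exact absurd (by linear_combination (3520895314878916609830646476582189/4444441167933833711628101001948420025558 - 843747772085201829301699109134484/317460083423845265116292928710601430397*z + 42579806215043846628486905725890387/17777764671735334846512404007793680102232*z^2)*hB + (-1875837057242312896859472924527917/4444441167933833711628101001948420025558 - 3108698175356009061073498022413324/2222220583966916855814050500974210012779*z - 22560609116465405234873479645513389/17777764671735334846512404007793680102232*z^2)*hC) (one_ne_zero (α := ℂ))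

/-! ## The hyperplane x₀ = 0 when i + j = 4
Here the binary quartics are squarefree, hence they have no common zero of their derivatives. -/

lemma zeroB13 (b d : ℂ) (h1 : 1*b^0*d^3+4*b^3 = 0) (h2 : 4*d^3+3*b^1*d^2 = 0) :
    b = 0 ∧ d = 0 := by
  have hd : d = 0 := by
    by_contra hd
    have e2 : (1)*4*d + 3*b = 0 := by
      apply mul_left_cancel₀ (pow_ne_zero 2 hd)
      linear_combination h2
    have e3 : b = -((1)*4)*d/3 := by linear_combination e2/3
    rw [e3] at h1
    have : d^3 = 0 := by linear_combination h1/(1-4*(1)*64/27)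
    exact hd (by simpa using this)
  subst hd
  exact ⟨by simpa using h1, rfl⟩

lemma zeroC13 (b d : ℂ) (h1 : 1*b^0*d^3+4*b^3 = 0) (h2 : -4*d^3+3*b^1*d^2 = 0) :
    b = 0 ∧ d = 0 := by
  have hd : d = 0 := by
    by_contra hd
    have e2 : (-1)*4*d + 3*b = 0 := by
      apply mul_left_cancel₀ (pow_ne_zero 2 hd)
      linear_combination h2
    have e3 : b = -((-1)*4)*d/3 := by linear_combination e2/3
    rw [e3] at h1
    have : d^3 = 0 := by linear_combination h1/(1-4*(-1)*64/27)
    exact hd (by simpa using this)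
  subst hd
  exact ⟨by simpa using h1, rfl⟩

lemma zeroB22 (b d : ℂ) (h1 : 2*b^1*d^2+4*b^3 = 0) (h2 : 4*d^3+2*b^2*d^1 = 0) :
    b = 0 ∧ d = 0 := by
  have hb : b = 0 := by
    by_contra hb
    have e2 : d^2 = -2*b^2 := by
      apply mul_left_cancel₀ hb
      linear_combination h1/2
    have e3 : d*b^2 = 0 := by linear_combination (h2-(1)*4*d*e2)/(2-(1)*8)
    have hd : d = 0 := by simpa [hb] using e3
    subst hd
    exact hb (by simpa using e2)
  subst hb
  exact ⟨rfl, by simpa using h2⟩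

lemma zeroC22 (b d : ℂ) (h1 : 2*b^1*d^2+4*b^3 = 0) (h2 : -4*d^3+2*b^2*d^1 = 0) :
    b = 0 ∧ d = 0 := by
  have hb : b = 0 := by
    by_contra hb
    have e2 : d^2 = -2*b^2 := by
      apply mul_left_cancel₀ hb
      linear_combination h1/2
    have e3 : d*b^2 = 0 := by linear_combination (h2-(-1)*4*d*e2)/(2-(-1)*8)
    have hd : d = 0 := by simpa [hb] using e3
    subst hd
    exact hb (by simpa using e2)
  subst hb
  exact ⟨rfl, by simpa using h2⟩

lemma zeroB31 (b d : ℂ) (h1 : 3*b^2*d^1+4*b^3 = 0) (h2 : 4*d^3+1*b^3*d^0 = 0) :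
    b = 0 ∧ d = 0 := by
  have hb : b = 0 := by
    by_contra hb
    have e2 : 3*d+4*b = 0 := by
      apply mul_left_cancel₀ (pow_ne_zero 2 hb)
      linear_combination h1
    have e3 : d = -4*b/3 := by linear_combination e2/3
    rw [e3] at h2
    have : b^3 = 0 := by linear_combination h2/(1-(1)*4*64/27)
    exact hb (by simpa using this)
  subst hb
  exact ⟨rfl, by simpa using h2⟩

lemma zeroC31 (b d : ℂ) (h1 : 3*b^2*d^1+4*b^3 = 0) (h2 : -4*d^3+1*b^3*d^0 = 0) :
    b = 0 ∧ d = 0 := by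
  have hb : b = 0 := by
    by_contra hb
    have e2 : 3*d+4*b = 0 := by
      apply mul_left_cancel₀ (pow_ne_zero 2 hb)
      linear_combination h1
    have e3 : d = -4*b/3 := by linear_combination e2/3
    rw [e3] at h2
    have : b^3 = 0 := by linear_combination h2/(1-(-1)*4*64/27)
    exact hb (by simpa using this)
  subst hb
  exact ⟨rfl, by simpa using h2⟩

/-! ## The full systems, by homogeneity reduced to x₀ = 0 or x₀ = 1 -/

lemma case12 (a b c d e : ℂ)
    (h0 : 2*(a*b-d^2)*b-2*(a*c-e^2)*c+(b^1*d^2+c^1*e^2) = 0)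
    (h1 : 2*(a*b-d^2)*a+a*(1*b^0*d^2)+4*b^3 = 0)
    (h2 : -2*(a*c-e^2)*a+a*(1*c^0*e^2)+4*c^3 = 0)
    (h3 : -4*(a*b-d^2)*d+a*(2*b^1*d^1) = 0)
    (h4 : 4*(a*c-e^2)*e+a*(2*c^1*e^1) = 0) :
    b = 0 ∧ c = 0 ∧ d = 0 ∧ e = 0 := by
  by_cases ha : a = 0
  · subst ha
    have hb : b = 0 := by simpa using h1
    have hc : c = 0 := by simpa using h2
    subst hb
    subst hc
    have hd : d^3 = 0 := by linear_combination h3/4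
    have he : e^3 = 0 := by linear_combination -h4/4
    exact ⟨rfl, rfl, by simpa using hd, by simpa using he⟩
  obtain ⟨b, rfl⟩ : ∃ t, b = a * t := ⟨b / a, by field_simp⟩
  obtain ⟨c, rfl⟩ : ∃ t, c = a * t := ⟨c / a, by field_simp⟩
  obtain ⟨d, rfl⟩ : ∃ t, d = a * t := ⟨d / a, by field_simp⟩
  obtain ⟨e, rfl⟩ : ∃ t, e = a * t := ⟨e / a, by field_simp⟩
  have ha3 : a^3 ≠ 0 := pow_ne_zero 3 ha
  have key := comb12 b c d e
    (by apply mul_left_cancel₀ ha3; linear_combination h0)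
    (by apply mul_left_cancel₀ ha3; linear_combination h1)
    (by apply mul_left_cancel₀ ha3; linear_combination h3)
    (by apply mul_left_cancel₀ ha3; linear_combination h2)
    (by apply mul_left_cancel₀ ha3; linear_combination h4)
  simpa [ha] using key

lemma case21 (a b c d e : ℂ)
    (h0 : 2*(a*b-d^2)*b-2*(a*c-e^2)*c+(b^2*d^1+c^2*e^1) = 0)
    (h1 : 2*(a*b-d^2)*a+a*(2*b^1*d^1)+4*b^3 = 0)
    (h2 : -2*(a*c-e^2)*a+a*(2*c^1*e^1)+4*c^3 = 0)
    (h3 : -4*(a*b-d^2)*d+a*(1*b^2*d^0) = 0)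
    (h4 : 4*(a*c-e^2)*e+a*(1*c^2*e^0) = 0) :
    b = 0 ∧ c = 0 ∧ d = 0 ∧ e = 0 := by
  by_cases ha : a = 0
  · subst ha
    have hb : b = 0 := by simpa using h1
    have hc : c = 0 := by simpa using h2
    subst hb
    subst hc
    have hd : d^3 = 0 := by linear_combination h3/4
    have he : e^3 = 0 := by linear_combination -h4/4
    exact ⟨rfl, rfl, by simpa using hd, by simpa using he⟩
  obtain ⟨b, rfl⟩ : ∃ t, b = a * t := ⟨b / a, by field_simp⟩
  obtain ⟨c, rfl⟩ : ∃ t, c = a * t := ⟨c / a, by field_simp⟩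
  obtain ⟨d, rfl⟩ : ∃ t, d = a * t := ⟨d / a, by field_simp⟩
  obtain ⟨e, rfl⟩ : ∃ t, e = a * t := ⟨e / a, by field_simp⟩
  have ha3 : a^3 ≠ 0 := pow_ne_zero 3 ha
  have key := comb21 b c d e
    (by apply mul_left_cancel₀ ha3; linear_combination h0)
    (by apply mul_left_cancel₀ ha3; linear_combination h1)
    (by apply mul_left_cancel₀ ha3; linear_combination h3)
    (by apply mul_left_cancel₀ ha3; linear_combination h2)
    (by apply mul_left_cancel₀ ha3; linear_combination h4)
  simpa [ha] using key

lemma case30 (a b c d e : ℂ)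
    (h0 : 2*(a*b-d^2)*b-2*(a*c-e^2)*c+(b^3*d^0+c^3*e^0) = 0)
    (h1 : 2*(a*b-d^2)*a+a*(3*b^2*d^0)+4*b^3 = 0)
    (h2 : -2*(a*c-e^2)*a+a*(3*c^2*e^0)+4*c^3 = 0)
    (h3 : -4*(a*b-d^2)*d+a*(0*b^3*d^0) = 0)
    (h4 : 4*(a*c-e^2)*e+a*(0*c^3*e^0) = 0) :
    b = 0 ∧ c = 0 ∧ d = 0 ∧ e = 0 := by
  by_cases ha : a = 0
  · subst ha
    have hb : b = 0 := by simpa using h1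
    have hc : c = 0 := by simpa using h2
    subst hb
    subst hc
    have hd : d^3 = 0 := by linear_combination h3/4
    have he : e^3 = 0 := by linear_combination -h4/4
    exact ⟨rfl, rfl, by simpa using hd, by simpa using he⟩
  obtain ⟨b, rfl⟩ : ∃ t, b = a * t := ⟨b / a, by field_simp⟩
  obtain ⟨c, rfl⟩ : ∃ t, c = a * t := ⟨c / a, by field_simp⟩
  obtain ⟨d, rfl⟩ : ∃ t, d = a * t := ⟨d / a, by field_simp⟩
  obtain ⟨e, rfl⟩ : ∃ t, e = a * t := ⟨e / a, by field_simp⟩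
  have ha3 : a^3 ≠ 0 := pow_ne_zero 3 ha
  have key := comb30 b c d e
    (by apply mul_left_cancel₀ ha3; linear_combination h0)
    (by apply mul_left_cancel₀ ha3; linear_combination h1)
    (by apply mul_left_cancel₀ ha3; linear_combination h3)
    (by apply mul_left_cancel₀ ha3; linear_combination h2)
    (by apply mul_left_cancel₀ ha3; linear_combination h4)
  simpa [ha] using key

lemma case13 (a b c d e : ℂ)
    (h0 : 2*(a*b-d^2)*b-2*(a*c-e^2)*c = 0)
    (h1 : 2*(a*b-d^2)*a+(1*b^0*d^3)+4*b^3 = 0)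
    (h2 : -2*(a*c-e^2)*a+(1*c^0*e^3)+4*c^3 = 0)
    (h3 : -4*(a*b-d^2)*d+(3*b^1*d^2) = 0)
    (h4 : 4*(a*c-e^2)*e+(3*c^1*e^2) = 0) :
    b = 0 ∧ c = 0 ∧ d = 0 ∧ e = 0 := by
  by_cases ha : a = 0
  · subst ha
    have hB := zeroB13 b d (by linear_combination h1) (by linear_combination h3)
    have hC := zeroC13 c e (by linear_combination h2) (by linear_combination h4)
    exact ⟨hB.1, hC.1, hB.2, hC.2⟩
  obtain ⟨b, rfl⟩ : ∃ t, b = a * t := ⟨b / a, by field_simp⟩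
  obtain ⟨c, rfl⟩ : ∃ t, c = a * t := ⟨c / a, by field_simp⟩
  obtain ⟨d, rfl⟩ : ∃ t, d = a * t := ⟨d / a, by field_simp⟩
  obtain ⟨e, rfl⟩ : ∃ t, e = a * t := ⟨e / a, by field_simp⟩
  have ha3 : a^3 ≠ 0 := pow_ne_zero 3 ha
  have key := comb13 b c d e
    (by apply mul_left_cancel₀ ha3; linear_combination h0/2)
    (by apply mul_left_cancel₀ ha3; linear_combination h1)
    (by apply mul_left_cancel₀ ha3; linear_combination h3)
    (by apply mul_left_cancel₀ ha3; linear_combination h2)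
    (by apply mul_left_cancel₀ ha3; linear_combination h4)
  simpa [ha] using key

lemma case22 (a b c d e : ℂ)
    (h0 : 2*(a*b-d^2)*b-2*(a*c-e^2)*c = 0)
    (h1 : 2*(a*b-d^2)*a+(2*b^1*d^2)+4*b^3 = 0)
    (h2 : -2*(a*c-e^2)*a+(2*c^1*e^2)+4*c^3 = 0)
    (h3 : -4*(a*b-d^2)*d+(2*b^2*d^1) = 0)
    (h4 : 4*(a*c-e^2)*e+(2*c^2*e^1) = 0) :
    b = 0 ∧ c = 0 ∧ d = 0 ∧ e = 0 := by
  by_cases ha : a = 0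
  · subst ha
    have hB := zeroB22 b d (by linear_combination h1) (by linear_combination h3)
    have hC := zeroC22 c e (by linear_combination h2) (by linear_combination h4)
    exact ⟨hB.1, hC.1, hB.2, hC.2⟩
  obtain ⟨b, rfl⟩ : ∃ t, b = a * t := ⟨b / a, by field_simp⟩
  obtain ⟨c, rfl⟩ : ∃ t, c = a * t := ⟨c / a, by field_simp⟩
  obtain ⟨d, rfl⟩ : ∃ t, d = a * t := ⟨d / a, by field_simp⟩
  obtain ⟨e, rfl⟩ : ∃ t, e = a * t := ⟨e / a, by field_simp⟩
  have ha3 : a^3 ≠ 0 := pow_ne_zero 3 ha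
  have key := comb22 b c d e
    (by apply mul_left_cancel₀ ha3; linear_combination h0/2)
    (by apply mul_left_cancel₀ ha3; linear_combination h1)
    (by apply mul_left_cancel₀ ha3; linear_combination h3)
    (by apply mul_left_cancel₀ ha3; linear_combination h2)
    (by apply mul_left_cancel₀ ha3; linear_combination h4)
  simpa [ha] using key

lemma case31 (a b c d e : ℂ)
    (h0 : 2*(a*b-d^2)*b-2*(a*c-e^2)*c = 0)
    (h1 : 2*(a*b-d^2)*a+(3*b^2*d^1)+4*b^3 = 0)
    (h2 : -2*(a*c-e^2)*a+(3*c^2*e^1)+4*c^3 = 0)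
    (h3 : -4*(a*b-d^2)*d+(1*b^3*d^0) = 0)
    (h4 : 4*(a*c-e^2)*e+(1*c^3*e^0) = 0) :
    b = 0 ∧ c = 0 ∧ d = 0 ∧ e = 0 := by
  by_cases ha : a = 0
  · subst ha
    have hB := zeroB31 b d (by linear_combination h1) (by linear_combination h3)
    have hC := zeroC31 c e (by linear_combination h2) (by linear_combination h4)
    exact ⟨hB.1, hC.1, hB.2, hC.2⟩
  obtain ⟨b, rfl⟩ : ∃ t, b = a * t := ⟨b / a, by field_simp⟩
  obtain ⟨c, rfl⟩ : ∃ t, c = a * t := ⟨c / a, by field_simp⟩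
  obtain ⟨d, rfl⟩ : ∃ t, d = a * t := ⟨d / a, by field_simp⟩
  obtain ⟨e, rfl⟩ : ∃ t, e = a * t := ⟨e / a, by field_simp⟩
  have ha3 : a^3 ≠ 0 := pow_ne_zero 3 ha
  have key := comb31 b c d e
    (by apply mul_left_cancel₀ ha3; linear_combination h0/2)
    (by apply mul_left_cancel₀ ha3; linear_combination h1)
    (by apply mul_left_cancel₀ ha3; linear_combination h3)
    (by apply mul_left_cancel₀ ha3; linear_combination h2)
    (by apply mul_left_cancel₀ ha3; linear_combination h4)
  simpa [ha] using key

lemma fwd_aux (i j : ℕ) (hi : 1 ≤ i) (h3 : 3 ≤ i + j) (h4 : i + j ≤ 4)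
    (hij : (i, j) ≠ (4, 0)) :
    (i = 1 ∧ j = 2) ∨ (i = 2 ∧ j = 1) ∨ (i = 3 ∧ j = 0) ∨ (i = 1 ∧ j = 3) ∨ (i = 2 ∧ j = 2) ∨
      (i = 3 ∧ j = 1) := by
  have : ¬ (i = 4 ∧ j = 0) := by
    rintro ⟨rfl, rfl⟩
    exact hij rfl
  omega

lemma fin_aux (v : Fin 5 → ℂ) (hv : v ≠ 0) (h1 : v 1 = 0) (h2 : v 2 = 0) (h3 : v 3 = 0)
    (h4 : v 4 = 0) : ∃ c : ℂ, c ≠ 0 ∧ v = c • (Pi.single (0 : Fin 5) (1 : ℂ) : Fin 5 → ℂ) := by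
  have hv' : v = v 0 • (Pi.single (0 : Fin 5) (1 : ℂ) : Fin 5 → ℂ) := by
    ext k
    fin_cases k <;> simp [h1, h2, h3, h4]
  refine ⟨v 0, ?_, hv'⟩
  intro h0
  rw [h0, zero_smul] at hv'
  exact hv hv'

lemma eval_pderiv_quartic (i j : ℕ) (v : Fin 5 → ℂ) (k : Fin 5) (δ : Fin 5 → ℂ)
    (hδ : ∀ l, δ l = if l = k then 1 else 0) :
    eval v (pderiv k (quarticXij i j)) =
      2 * (v 0 * v 1 - v 3 ^ 2) * (v 0 * δ 1 + δ 0 * v 1 - 2 * v 3 * δ 3)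
      - 2 * (v 0 * v 2 - v 4 ^ 2) * (v 0 * δ 2 + δ 0 * v 2 - 2 * v 4 * δ 4)
      + ((4 - (i + j) : ℕ) : ℂ) * v 0 ^ (4 - (i + j) - 1) * δ 0 * (v 1 ^ i * v 3 ^ j + v 2 ^ i * v 4 ^ j)
      + v 0 ^ (4 - (i + j)) * (i * v 1 ^ (i - 1) * δ 1 * v 3 ^ j + v 1 ^ i * (j * v 3 ^ (j - 1) * δ 3)
        + i * v 2 ^ (i - 1) * δ 2 * v 4 ^ j + v 2 ^ i * (j * v 4 ^ (j - 1) * δ 4))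
      + 4 * v 1 ^ 3 * δ 1 + 4 * v 2 ^ 3 * δ 2 := by
  have hX : ∀ l, eval v (pderiv k (X l : MvPolynomial (Fin 5) ℂ)) = δ l := by
    intro l
    rw [hδ, pderiv_X, Pi.single_apply]
    split_ifs <;> simp
  simp only [quarticXij, map_add, map_sub, Derivation.leibniz, Derivation.leibniz_pow, map_mul,
    map_pow, smul_eq_mul, nsmul_eq_mul, map_natCast, eval_X, hX]
  push_cast
  ring

/-- The quartic hypersurface `X^{i,j} ⊂ ℙ⁴` (with `i ≥ 1`, `3 ≤ i+j ≤ 4`, `(i,j) ≠ (4,0)`)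
has exactly one singular point, namely `P = (1:0:0:0:0)`: all five partial derivatives
vanish at a nonzero `v ∈ ℂ⁵` iff `v` is a nonzero scalar multiple of `e₀`. -/
theorem singular_locus_quarticXij (i j : ℕ) (hi : 1 ≤ i) (h3 : 3 ≤ i + j) (h4 : i + j ≤ 4)
    (hij : (i, j) ≠ (4, 0)) :
    ∀ v : Fin 5 → ℂ, v ≠ 0 →
      ((∀ k : Fin 5, eval v (pderiv k (quarticXij i j)) = 0) ↔
        ∃ c : ℂ, c ≠ 0 ∧ v = c • (Pi.single (0 : Fin 5) (1 : ℂ) : Fin 5 → ℂ)) := by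
  intro v hv
  have hD : ∀ k, eval v (pderiv k (quarticXij i j)) = _ := fun k =>
    eval_pderiv_quartic i j v k (fun l => if l = k then 1 else 0) (fun _ => rfl)
  have hcase := fwd_aux i j hi h3 h4 hij
  constructor
  swap
  · rintro ⟨c, hc, rfl⟩ k
    rw [hD]
    rcases hcase with ⟨rfl, rfl⟩ | ⟨rfl, rfl⟩ | ⟨rfl, rfl⟩ | ⟨rfl, rfl⟩ | ⟨rfl, rfl⟩ | ⟨rfl, rfl⟩ <;>
      fin_cases k <;> simp
  intro h
  simp only [hD] at h
  clear hD
  have q0 := h 0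
  have q1 := h 1
  have q2 := h 2
  have q3 := h 3
  have q4 := h 4
  clear h
  rcases hcase with ⟨rfl, rfl⟩ | ⟨rfl, rfl⟩ | ⟨rfl, rfl⟩ | ⟨rfl, rfl⟩ | ⟨rfl, rfl⟩ | ⟨rfl, rfl⟩ <;>
    norm_num [Fin.ext_iff, -mul_eq_zero] at q0 q1 q2 q3 q4
  · have hk := case12 (v 0) (v 1) (v 2) (v 3) (v 4) (by linear_combination q0) (by linear_combination q1)
      (by linear_combination q2) (by linear_combination q3) (by linear_combination q4)
    exact fin_aux v hv hk.1 hk.2.1 hk.2.2.1 hk.2.2.2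
  · have hk := case21 (v 0) (v 1) (v 2) (v 3) (v 4) (by linear_combination q0) (by linear_combination q1)
      (by linear_combination q2) (by linear_combination q3) (by linear_combination q4)
    exact fin_aux v hv hk.1 hk.2.1 hk.2.2.1 hk.2.2.2
  · have hk := case30 (v 0) (v 1) (v 2) (v 3) (v 4) (by linear_combination q0) (by linear_combination q1)
      (by linear_combination q2) (by linear_combination -q3) (by linear_combination q4)
    exact fin_aux v hv hk.1 hk.2.1 hk.2.2.1 hk.2.2.2
  · have hk := case13 (v 0) (v 1) (v 2) (v 3) (v 4) (by linear_combination q0) (by linear_combination q1)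
      (by linear_combination q2) (by linear_combination q3) (by linear_combination q4)
    exact fin_aux v hv hk.1 hk.2.1 hk.2.2.1 hk.2.2.2
  · have hk := case22 (v 0) (v 1) (v 2) (v 3) (v 4) (by linear_combination q0) (by linear_combination q1)
      (by linear_combination q2) (by linear_combination q3) (by linear_combination q4)
    exact fin_aux v hv hk.1 hk.2.1 hk.2.2.1 hk.2.2.2
  · have hk := case31 (v 0) (v 1) (v 2) (v 3) (v 4) (by linear_combination q0) (by linear_combination q1)
      (by linear_combination q2) (by linear_combination q3) (by linear_combination q4)
    exact fin_aux v hv hk.1 hk.2.1 hk.2.2.1 hk.2.2.2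
end

section
/- Let F = (x₀x₁ − x₃²)² − (x₀x₂ − x₄²)² + x₀(x₃³ + x₄³) + x₁⁴ + x₂⁴ ∈ ℂ[x₀,…,x₄] (the quartic X^{0,3}, which has a cA₂ point at P). Then for every nonzero v ∈ ℂ⁵, all five partial derivatives of F vanish at v if and only if v is a nonzero scalar multiple of e₀ = (1,0,0,0,0); i.e., the quartic hypersurface {F = 0} ⊂ ℙ⁴ has exactly one singular point P = (1:0:0:0:0). -/
open MvPolynomial

/-- The quartic `X^{0,3}`:
`(x₀x₁ − x₃²)² − (x₀x₂ − x₄²)² + x₀(x₃³ + x₄³) + x₁⁴ + x₂⁴`. -/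
noncomputable def quarticX03 : MvPolynomial (Fin 5) ℂ :=
  (X 0 * X 1 - (X 3) ^ 2) ^ 2 - (X 0 * X 2 - (X 4) ^ 2) ^ 2 +
    X 0 * ((X 3) ^ 3 + (X 4) ^ 3) + (X 1) ^ 4 + (X 2) ^ 4

theorem branchU (b d : ℂ) (h1 : b - d^2 + 2*b^3 = 0) (h2 : d*(8*b^3+3*d) = 0) :
    (b = 0 ∧ d = 0) ∨ -48*(-4*b^4+d^3) = 48 ∨
      ∃ u : ℂ, u = -48*(-4*b^4+d^3) ∧ (-1331331876)*u^0 + (119692323/2)*u^1 + (-48085569/64)*u^2 + (-369117/16)*u^3 + (-243/4)*u^4 + (1)*u^5 = 0 := by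
  rcases mul_eq_zero.mp h2 with hd | hd
  · subst hd
    have h3 : b * (1 + 2*b^2) = 0 := by linear_combination h1
    rcases mul_eq_zero.mp h3 with hb | hb
    · exact Or.inl ⟨hb, rfl⟩
    · refine Or.inr (Or.inl ?_)
      linear_combination (96*b^2 - 48) * hb
  · have hd' : d = -(8/3)*b^3 := by linear_combination hd/3
    subst hd'
    have h3 : b * (9 + 18*b^2 - 64*b^5) = 0 := by linear_combination 9*h1
    rcases mul_eq_zero.mp h3 with hb | hb
    · left; subst hb; simp
    · refine Or.inr (Or.inr ⟨_, rfl, ?_⟩)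
      obtain ⟨t, ht⟩ : ∃ t : ℂ, t = 2*b := ⟨_, rfl⟩
      have hbt : b = t/2 := by rw [ht]; ring
      subst hbt
      have hf : 4*t^5 - 9*t^2 - 18 = 0 := by linear_combination (-2)*hb
      have hu : -48*(-4*(t/2)^4+(-(8/3)*(t/2)^3)^3) = 20*t^4+9*t^3+18*t := by
        linear_combination (4/9*t^4 + t)*hf
      rw [hu]
      linear_combination ((73962882)*t^0 + (-119692323/2)*t^1 + (-750635991/32)*t^2 + (29898477/4)*t^3 + (-2616875991/64)*t^4 + (430874559/8)*t^5 + (144600795/4)*t^6 + (-81580041/8)*t^7 + (100583775/4)*t^8 + (26730000)*t^9 + (29039049/4)*t^10 + (8264025)*t^11 + (6129000)*t^12 + (1620000)*t^13 + (1800000)*t^14 + (800000)*t^15) * hf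

theorem branchW (b d : ℂ) (h1 : b - d^2 - 2*b^3 = 0) (h2 : d*(8*b^3+3*d) = 0) :
    (b = 0 ∧ d = 0) ∨ -48*(-4*b^4+d^3) = 48 ∨
      ∃ u : ℂ, u = -48*(-4*b^4+d^3) ∧ (-1293068124)*u^0 + (116503677/2)*u^1 + (-47022687/64)*u^2 + (408483/16)*u^3 + (243/4)*u^4 + (1)*u^5 = 0 := by
  rcases mul_eq_zero.mp h2 with hd | hd
  · subst hd
    have h3 : b * (1 - 2*b^2) = 0 := by linear_combination h1
    rcases mul_eq_zero.mp h3 with hb | hb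
    · exact Or.inl ⟨hb, rfl⟩
    · refine Or.inr (Or.inl ?_)
      linear_combination (-96*b^2 - 48) * hb
  · have hd' : d = -(8/3)*b^3 := by linear_combination hd/3
    subst hd'
    have h3 : b * (9 - 18*b^2 - 64*b^5) = 0 := by linear_combination 9*h1
    rcases mul_eq_zero.mp h3 with hb | hb
    · left; subst hb; simp
    · refine Or.inr (Or.inr ⟨_, rfl, ?_⟩)
      obtain ⟨t, ht⟩ : ∃ t : ℂ, t = 2*b := ⟨_, rfl⟩
      have hbt : b = t/2 := by rw [ht]; ring
      subst hbt
      have hf : 4*t^5 + 9*t^2 - 18 = 0 := by linear_combination (-2)*hb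
      have hu : -48*(-4*(t/2)^4+(-(8/3)*(t/2)^3)^3) = 20*t^4+9*t^3-18*t := by
        linear_combination (4/9*t^4 - t)*hf
      rw [hu]
      linear_combination ((71837118)*t^0 + (116503677/2)*t^1 + (1572598071/32)*t^2 + (33087123/4)*t^3 + (-3438838071/64)*t^4 + (-172737441/8)*t^5 + (-149915205/4)*t^6 + (178682841/8)*t^7 + (103536225/4)*t^8 + (26730000)*t^9 + (-120951/4)*t^10 + (-7935975)*t^11 + (-4671000)*t^12 + (1620000)*t^13 + (1800000)*t^14 + (800000)*t^15) * hf

theorem coprimeUW (u w : ℂ) (h : u + w = 0) (hu : (-1331331876)*u^0 + (119692323/2)*u^1 + (-48085569/64)*u^2 + (-369117/16)*u^3 + (-243/4)*u^4 + (1)*u^5 = 0) (hw : (-1293068124)*w^0 + (116503677/2)*w^1 + (-47022687/64)*w^2 + (408483/16)*w^3 + (243/4)*w^4 + (1)*w^5 = 0) : False := by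
  have hw' : w = -u := by linear_combination h
  subst hw'
  have : (1 : ℂ) = 0 := by
    linear_combination ((-842511883565964273301676563057/2267837842205264988017016345051548977608)*u^0 + (-37816611780965283046966589795/8063423438952053290727169226849951920384)*u^1 + (-918689021574937647288992453/6047567579214039968045376920137463940288)*u^2 + (42409170138320397623080837/122463243479084309352918882632783644790832)*u^3 + (-28136202885532231751/4666333008652808617318963672945574028)*u^4) * hu + ((-886399482309948429517792809199/2267837842205264988017016345051548977608)*u^0 + (42271869080673469617300144317/8063423438952053290727169226849951920384)*u^1 + (853486598892041288886793147/6047567579214039968045376920137463940288)*u^2 + (42409170138320397623080837/122463243479084309352918882632783644790832)*u^3 + (-28136202885532231751/4666333008652808617318963672945574028)*u^4) * hw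
  exact one_ne_zero this

theorem affineCase (b c d e : ℂ) (h0 : -4*b^4 - 4*c^4 + d^3 + e^3 = 0)
    (h1 : b - d^2 + 2*b^3 = 0) (h2 : c - e^2 - 2*c^3 = 0)
    (h3 : d*(8*b^3+3*d) = 0) (h4 : e*(8*c^3+3*e) = 0) : b = 0 ∧ c = 0 ∧ d = 0 ∧ e = 0 := by
  have key : -48*(-4*b^4+d^3) + -48*(-4*c^4+e^3) = 0 := by linear_combination -48*h0
  rcases branchU b d h1 h3 with ⟨hb, hd⟩ | hu | ⟨u, hu, hu'⟩ <;>
  rcases branchW c e h2 h4 with ⟨hc, he⟩ | hw | ⟨w, hw, hw'⟩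
  · exact ⟨hb, hc, hd, he⟩
  · rw [hw, hb, hd] at key; norm_num at key
  · rw [← hw, hb, hd] at key
    have : w = 0 := by linear_combination key
    subst this; norm_num at hw'
  · rw [hu, hc, he] at key; norm_num at key
  · rw [hu, hw] at key; norm_num at key
  · rw [hu, ← hw] at key
    have : w = -48 := by linear_combination key
    subst this; norm_num at hw'
  · rw [← hu, hc, he] at key
    have : u = 0 := by linear_combination key
    subst this; norm_num at hu'
  · rw [← hu, hw] at key
    have : u = -48 := by linear_combination key
    subst this; norm_num at hu'
  · rw [← hu, ← hw] at key
    exact (coprimeUW u w key hu' hw').elim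

theorem projCase (a b c d e : ℂ)
    (h0 : 2*(a*b-d^2)*b - 2*(a*c-e^2)*c + (d^3+e^3) = 0)
    (h1 : 2*(a*b-d^2)*a + 4*b^3 = 0) (h2 : -2*(a*c-e^2)*a + 4*c^3 = 0)
    (h3 : -4*(a*b-d^2)*d + 3*a*d^2 = 0) (h4 : 4*(a*c-e^2)*e + 3*a*e^2 = 0) :
    b = 0 ∧ c = 0 ∧ d = 0 ∧ e = 0 := by
  by_cases ha : a = 0
  · subst ha
    have hb : b = 0 := by
      have : b^3 = 0 := by linear_combination h1/4
      simpa using this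
    have hc : c = 0 := by
      have : c^3 = 0 := by linear_combination h2/4
      simpa using this
    have hd : d = 0 := by
      have : d^3 = 0 := by linear_combination h3/4
      simpa using this
    have he : e = 0 := by
      have : e^3 = 0 := by linear_combination -h4/4
      simpa using this
    exact ⟨hb, hc, hd, he⟩
  · obtain ⟨b, rfl⟩ : ∃ x, b = a*x := ⟨b/a, by field_simp⟩
    obtain ⟨c, rfl⟩ : ∃ x, c = a*x := ⟨c/a, by field_simp⟩
    obtain ⟨d, rfl⟩ : ∃ x, d = a*x := ⟨d/a, by field_simp⟩
    obtain ⟨e, rfl⟩ : ∃ x, e = a*x := ⟨e/a, by field_simp⟩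
    have ha3 : a^3 ≠ 0 := pow_ne_zero _ ha
    have k1 : b - d^2 + 2*b^3 = 0 := by
      apply mul_left_cancel₀ ha3; linear_combination h1/2
    have k2 : c - e^2 - 2*c^3 = 0 := by
      apply mul_left_cancel₀ ha3; linear_combination -h2/2
    have k3 : d*(8*b^3+3*d) = 0 := by
      apply mul_left_cancel₀ ha3; linear_combination h3 + 4*a^3*d*k1
    have k4 : e*(8*c^3+3*e) = 0 := by
      apply mul_left_cancel₀ ha3; linear_combination h4 - 4*a^3*e*k2
    have k0 : -4*b^4 - 4*c^4 + d^3 + e^3 = 0 := by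
      apply mul_left_cancel₀ ha3
      linear_combination h0 - 2*a^3*b*k1 + 2*a^3*c*k2
    obtain ⟨hb, hc, hd, he⟩ := affineCase b c d e k0 k1 k2 k3 k4
    simp [hb, hc, hd, he]

/-- The quartic hypersurface `X^{0,3} ⊂ ℙ⁴` has exactly one singular point
`P = (1:0:0:0:0)`: all five partial derivatives vanish at a nonzero `v ∈ ℂ⁵`
iff `v` is a nonzero scalar multiple of `e₀`. -/
theorem singular_locus_quarticX03 :
    ∀ v : Fin 5 → ℂ, v ≠ 0 →
      ((∀ k : Fin 5, eval v (pderiv k quarticX03) = 0) ↔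
        ∃ c : ℂ, c ≠ 0 ∧ v = c • (Pi.single (0 : Fin 5) (1 : ℂ) : Fin 5 → ℂ)) := by
  intro v hv
  constructor
  · intro h
    have h0 := h 0
    have h1 := h 1
    have h2 := h 2
    have h3 := h 3
    have h4 := h 4
    simp [quarticX03, pderiv_X, Pi.single_apply, Derivation.leibniz_pow] at h0 h1 h2 h3 h4
    obtain ⟨hb, hc, hd, he⟩ := projCase (v 0) (v 1) (v 2) (v 3) (v 4)
      (by linear_combination h0) (by linear_combination h1) (by linear_combination h2)
      (by linear_combination h3) (by linear_combination h4)
    have hv' : v = v 0 • (Pi.single (0 : Fin 5) (1 : ℂ) : Fin 5 → ℂ) := by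
      funext i
      fin_cases i <;> simp [hb, hc, hd, he]
    refine ⟨v 0, ?_, hv'⟩
    intro h
    apply hv
    rw [hv', h, zero_smul]
  · rintro ⟨c, hc, rfl⟩ k
    fin_cases k <;>
      simp [quarticX03, pderiv_X, Pi.single_apply, Derivation.leibniz_pow]
end

section
/- Let F = (x₀x₁ − x₃²)² − (x₀x₂ − x₄²)² + x₀x₁³ − x₁²x₃² + x₁⁴ + x₂⁴ ∈ ℂ[x₀,…,x₄] (the quartic of Example 4.5 with a cA₇ point). Then for every nonzero v ∈ ℂ⁵, all five partial derivatives of F vanish at v if and only if v is a nonzero scalar multiple of e₀ = (1,0,0,0,0); i.e., the quartic hypersurface {F = 0} ⊂ ℙ⁴ has exactly one singular point P = (1:0:0:0:0). -/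
open MvPolynomial

/-- The quartic of Example 4.5 (with a `cA₇` point):
`(x₀x₁ − x₃²)² − (x₀x₂ − x₄²)² + x₀x₁³ − x₁²x₃² + x₁⁴ + x₂⁴`. -/
noncomputable def quarticCA7 : MvPolynomial (Fin 5) ℂ :=
  (X 0 * X 1 - (X 3) ^ 2) ^ 2 - (X 0 * X 2 - (X 4) ^ 2) ^ 2 +
    X 0 * (X 1) ^ 3 - (X 1) ^ 2 * (X 3) ^ 2 + (X 1) ^ 4 + (X 2) ^ 4

theorem quarticCA7_aux (a b c d e : ℂ)
    (h0 : b * (2 * (a * b - d ^ 2) + b ^ 2) = 2 * (a * c - e ^ 2) * c)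
    (h1 : (a + b) * (2 * (a * b - d ^ 2) + b ^ 2) + 3 * b ^ 3 = 0)
    (h2 : (a * c - e ^ 2) * a = 2 * c ^ 3)
    (h3 : d * (2 * (a * b - d ^ 2) + b ^ 2) = 0)
    (h4 : (a * c - e ^ 2) * e = 0) : b = 0 ∧ c = 0 ∧ d = 0 ∧ e = 0 := by
  by_cases hU : 2 * (a * b - d ^ 2) + b ^ 2 = 0
  · rw [hU] at h0 h1
    have hb : b = 0 := by simpa using h1
    subst hb
    have hd : d = 0 := by simpa using hU
    subst hd
    have h0' : (a * c - e ^ 2) * c = 0 := by linear_combination -h0 / 2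
    rcases mul_eq_zero.mp h0' with hB | hc
    · rw [hB] at h2
      have hc : c = 0 := by simpa using h2.symm
      subst hc
      have he : e = 0 := by simpa using hB
      exact ⟨rfl, rfl, rfl, he⟩
    · subst hc
      have he : e ^ 3 = 0 := by linear_combination -h4
      exact ⟨rfl, rfl, rfl, by simpa using he⟩
  · exfalso
    have hd : d = 0 := (mul_eq_zero.mp h3).resolve_right hU
    subst hd
    have hb : b ≠ 0 := by
      rintro rfl
      apply hU
      ring
    have hBc : (a * c - e ^ 2) * c ≠ 0 := by
      intro h
      apply mul_ne_zero hb hU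
      linear_combination h0 + 2 * h
    have hc := right_ne_zero_of_mul hBc
    have he : e = 0 := (mul_eq_zero.mp h4).resolve_left (left_ne_zero_of_mul hBc)
    subst he
    have hac : a ^ 2 = 2 * c ^ 2 := mul_right_cancel₀ hc (by linear_combination h2)
    have hP : 2 * a ^ 2 + 3 * a * b + 4 * b ^ 2 = 0 :=
      (mul_eq_zero.mp (by linear_combination h1 :
        b * (2 * a ^ 2 + 3 * a * b + 4 * b ^ 2) = 0)).resolve_left hb
    have hQ : (a + b) * (a ^ 2 - a * b - b ^ 2) = 0 := by
      linear_combination a * hac - h0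
    rcases mul_eq_zero.mp hQ with h | h
    · have ha : a = -b := by linear_combination h
      subst ha
      have : b ^ 2 = 0 := by linear_combination hP / 3
      exact hb (by simpa using this)
    · have h5 : 5 * a + 6 * b = 0 :=
        (mul_eq_zero.mp (by linear_combination hP - 2 * h :
          b * (5 * a + 6 * b) = 0)).resolve_left hb
      have ha : a = -(6 / 5) * b := by linear_combination h5 / 5
      subst ha
      have : b ^ 2 = 0 := by linear_combination 25 / 41 * h
      exact hb (by simpa using this)

/-- The quartic hypersurface of Example 4.5 has exactly one singular point
`P = (1:0:0:0:0)`: all five partial derivatives vanish at a nonzero `v ∈ ℂ⁵`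
iff `v` is a nonzero scalar multiple of `e₀`. -/
theorem singular_locus_quarticCA7 :
    ∀ v : Fin 5 → ℂ, v ≠ 0 →
      ((∀ k : Fin 5, eval v (pderiv k quarticCA7) = 0) ↔
        ∃ c : ℂ, c ≠ 0 ∧ v = c • (Pi.single (0 : Fin 5) (1 : ℂ) : Fin 5 → ℂ)) := by
  intro v hv
  constructor
  · intro h
    have h0 := h 0
    have h1 := h 1
    have h2 := h 2
    have h3 := h 3
    have h4 := h 4
    simp [quarticCA7, pderiv_X, Pi.single_apply, Derivation.leibniz_pow] at h0 h1 h2 h3 h4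
    obtain ⟨hb, hc, hd, he⟩ := quarticCA7_aux (v 0) (v 1) (v 2) (v 3) (v 4)
      (by linear_combination h0) (by linear_combination h1)
      (by linear_combination -h2 / 2) (by grind) (by grind)
    have hvv : v = v 0 • (Pi.single (0 : Fin 5) (1 : ℂ) : Fin 5 → ℂ) := by
      funext i
      fin_cases i <;> simp [hb, hc, hd, he]
    refine ⟨v 0, ?_, hvv⟩
    intro h00
    apply hv
    rw [hvv, h00, zero_smul]
  · rintro ⟨c, hc, rfl⟩ k
    fin_cases k <;> simp [quarticCA7, pderiv_X, Pi.single_apply, Derivation.leibniz_pow]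
end

section
/- Let F = x₀x₁(x₀x₂ − x₄²) + x₀(x₂³ + x₃³) − x₁⁴ + x₂⁴ + x₃⁴ ∈ ℂ[x₀,…,x₄] (the quartic of Example 4.7). Then for every nonzero v ∈ ℂ⁵, all five partial derivatives of F vanish at v if and only if v is a nonzero scalar multiple of e₀ = (1,0,0,0,0) or of e₄ = (0,0,0,0,1); i.e., the singular locus of the quartic hypersurface {F = 0} ⊂ ℙ⁴ is exactly the two points P = (1:0:0:0:0) and P₄ = (0:0:0:0:1). -/
open MvPolynomial

/-- The quartic of Example 4.7:
`x₀x₁(x₀x₂ − x₄²) + x₀(x₂³ + x₃³) − x₁⁴ + x₂⁴ + x₃⁴`. -/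
noncomputable def quarticEx47 : MvPolynomial (Fin 5) ℂ :=
  X 0 * X 1 * (X 0 * X 2 - (X 4) ^ 2) + X 0 * ((X 2) ^ 3 + (X 3) ^ 3) -
    (X 1) ^ 4 + (X 2) ^ 4 + (X 3) ^ 4

/-- The two univariate equations arising in the last case are coprime. -/
lemma bezout_aux (t : ℂ) (hp : 2*t^8+3*t^5+2 = 0) (hq : 12*t^6-32*t^4+8*t+27 = 0) : False := by
  have h : (1:ℂ) = 0 := by
    linear_combination ((240392563184/451819230529)*t^0+(-184096926182/451819230529)*t^1+(94544178632/451819230529)*t^2+(-71409532576/451819230529)*t^3+(-73340799420/451819230529)*t^4+(60889935984/451819230529)*t^5) * hp + ((-1072810957/451819230529)*t^0+(13954679260/451819230529)*t^1+(-11137992272/451819230529)*t^2+(8589740864/451819230529)*t^3+(1616063752/451819230529)*t^4+(-15160605008/451819230529)*t^5+(12223466570/451819230529)*t^6+(-10148322664/451819230529)*t^7) * hq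
  exact one_ne_zero h

lemma core_aux (a b c d e : ℂ)
    (h0 : 2*a*b*c - b*e^2 + c^3 + d^3 = 0)
    (h1 : a^2*c - a*e^2 - 4*b^3 = 0)
    (h2 : a^2*b + 3*a*c^2 + 4*c^3 = 0)
    (h3 : 3*a*d^2 + 4*d^3 = 0)
    (h4 : a*b*e = 0) :
    (b = 0 ∧ c = 0 ∧ d = 0 ∧ e = 0) ∨ (a = 0 ∧ b = 0 ∧ c = 0 ∧ d = 0) := by
  by_cases ha : a = 0
  · subst ha
    have hb : b = 0 := by simpa using h1
    have hc : c = 0 := by simpa using h2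
    have hd : d = 0 := by simpa using h3
    exact Or.inr ⟨rfl, hb, hc, hd⟩
  left
  have hd : d = 0 ∨ d = -3*a/4 := by
    have : d^2 * (d + 3*a/4) = 0 := by linear_combination h3/4
    rcases mul_eq_zero.1 this with h | h
    · left; simpa using h
    · right; linear_combination h
  by_cases hb : b = 0
  · subst hb
    have hc : c = 0 ∨ c = -3*a/4 := by
      have : c^2 * (c + 3*a/4) = 0 := by linear_combination h2/4
      rcases mul_eq_zero.1 this with h | h
      · left; simpa using h
      · right; linear_combination h
    have ha3 : a^3 ≠ 0 := pow_ne_zero 3 ha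
    rcases hc with rfl | rfl <;> rcases hd with rfl | rfl
    · refine ⟨rfl, rfl, rfl, ?_⟩
      have : a * e^2 = 0 := by linear_combination -h1
      simpa [ha] using this
    · exact absurd (by linear_combination (-64/27)*h0) ha3
    · exact absurd (by linear_combination (-64/27)*h0) ha3
    · exact absurd (by linear_combination (-32/27)*h0) ha3
  exfalso
  have he : e = 0 := by simpa [ha, hb] using h4
  subst he
  obtain ⟨t, rfl⟩ : ∃ t, b = a*t/2 := ⟨2*b/a, by field_simp⟩
  have ht : t ≠ 0 := by rintro rfl; simp at hb
  have hc : c = a*t^3/2 := by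
    have : a^2 * (c - a*t^3/2) = 0 := by linear_combination h1
    have := (mul_eq_zero.1 this).resolve_left (pow_ne_zero 2 ha)
    linear_combination this
  subst hc
  have hp : 2*t^8+3*t^5+2 = 0 := by
    have : (a^3*t) * (2*t^8+3*t^5+2) = 0 := by linear_combination 4*h2
    exact (mul_eq_zero.1 this).resolve_left (mul_ne_zero (pow_ne_zero 3 ha) ht)
  rcases hd with rfl | rfl
  · have h5 : t^5 = -4 := by
      have : (a^3*t^4) * (t^5+4) = 0 := by linear_combination 8*h0
      have := (mul_eq_zero.1 this).resolve_left (mul_ne_zero (pow_ne_zero 3 ha) (pow_ne_zero 4 ht))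
      linear_combination this
    have h8 : t^8 = 5 := by linear_combination hp/2 - 3/2*h5
    have e1 : (t^5)^8 = (t^8)^5 := by ring
    rw [h5, h8] at e1
    norm_num at e1
  · have h9 : 8*t^9+32*t^4-27 = 0 := by
      have : a^3 * (8*t^9+32*t^4-27) = 0 := by linear_combination 64*h0
      exact (mul_eq_zero.1 this).resolve_left (pow_ne_zero 3 ha)
    exact bezout_aux t hp (by linear_combination 4*t*hp - h9)

theorem singular_locus_quarticEx47 :
    ∀ v : Fin 5 → ℂ, v ≠ 0 →
      ((∀ k : Fin 5, eval v (pderiv k quarticEx47) = 0) ↔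
        ∃ c : ℂ, c ≠ 0 ∧
          (v = c • (Pi.single (0 : Fin 5) (1 : ℂ) : Fin 5 → ℂ) ∨
            v = c • (Pi.single (4 : Fin 5) (1 : ℂ) : Fin 5 → ℂ))) := by
  intro v hv
  constructor
  · intro h
    have h0 := h 0
    have h1 := h 1
    have h2 := h 2
    have h3 := h 3
    have h4 := h 4
    simp [quarticEx47, pderiv_X, Pi.single_apply] at h0 h1 h2 h3 h4
    have key := core_aux (v 0) (v 1) (v 2) (v 3) (v 4) (by linear_combination h0)
      (by linear_combination h1) (by linear_combination h2) (by linear_combination h3)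
      (by rcases h4 with (h | h) | h <;> simp [h])
    rcases key with ⟨k1, k2, k3, k4⟩ | ⟨k1, k2, k3, k4⟩
    · have e : v = v 0 • (Pi.single (0 : Fin 5) (1 : ℂ) : Fin 5 → ℂ) := by
        ext i; fin_cases i <;> simp [k1, k2, k3, k4]
      refine ⟨v 0, fun z => hv ?_, Or.inl e⟩
      rw [e, z, zero_smul]
    · have e : v = v 4 • (Pi.single (4 : Fin 5) (1 : ℂ) : Fin 5 → ℂ) := by
        ext i; fin_cases i <;> simp [k1, k2, k3, k4]
      refine ⟨v 4, fun z => hv ?_, Or.inr e⟩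
      rw [e, z, zero_smul]
  · rintro ⟨c, -, rfl | rfl⟩ k <;> fin_cases k <;>
      simp [quarticEx47, pderiv_X, Pi.single_apply]
end

section
/- Let F = x₀²x₁² + x₀x₂²x₃ + x₁⁴ + x₂⁴ + x₃⁴ + x₄⁴ ∈ ℂ[x₀,…,x₄] (the quartic of Example 4.9 with a cD₅ point). Then for every nonzero v ∈ ℂ⁵, all five partial derivatives of F vanish at v if and only if v is a nonzero scalar multiple of e₀ = (1,0,0,0,0); i.e., the quartic hypersurface {F = 0} ⊂ ℙ⁴ has exactly one singular point P = (1:0:0:0:0). -/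
open MvPolynomial

/-- The quartic of Example 4.9 (with a `cD₅` point):
`x₀²x₁² + x₀x₂²x₃ + x₁⁴ + x₂⁴ + x₃⁴ + x₄⁴`. -/
noncomputable def quarticCD5 : MvPolynomial (Fin 5) ℂ :=
  (X 0) ^ 2 * (X 1) ^ 2 + X 0 * (X 2) ^ 2 * X 3 +
    (X 1) ^ 4 + (X 2) ^ 4 + (X 3) ^ 4 + (X 4) ^ 4

/-- The quartic hypersurface of Example 4.9 has exactly one singular point
`P = (1:0:0:0:0)`: all five partial derivatives vanish at a nonzero `v ∈ ℂ⁵`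
iff `v` is a nonzero scalar multiple of `e₀`. -/
theorem singular_locus_quarticCD5 :
    ∀ v : Fin 5 → ℂ, v ≠ 0 →
      ((∀ k : Fin 5, eval v (pderiv k quarticCD5) = 0) ↔
        ∃ c : ℂ, c ≠ 0 ∧ v = c • (Pi.single (0 : Fin 5) (1 : ℂ) : Fin 5 → ℂ)) := by
  intro v hv
  have key : (∀ k : Fin 5, eval v (pderiv k quarticCD5) = 0) ↔
      (2 * v 0 * v 1 ^ 2 + v 2 ^ 2 * v 3 = 0 ∧
       2 * v 0 ^ 2 * v 1 + 4 * v 1 ^ 3 = 0 ∧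
       2 * v 0 * v 2 * v 3 + 4 * v 2 ^ 3 = 0 ∧
       v 0 * v 2 ^ 2 + 4 * v 3 ^ 3 = 0 ∧
       4 * v 4 ^ 3 = 0) := by
    rw [Fin.forall_fin_succ, Fin.forall_fin_succ, Fin.forall_fin_succ,
      Fin.forall_fin_succ, Fin.forall_fin_one]
    have h0 : eval v (pderiv 0 quarticCD5) = 2 * v 0 * v 1 ^ 2 + v 2 ^ 2 * v 3 := by
      simp [quarticCD5, pderiv_X]; ring
    have h1 : eval v (pderiv 1 quarticCD5) = 2 * v 0 ^ 2 * v 1 + 4 * v 1 ^ 3 := by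
      simp [quarticCD5, pderiv_X]; ring
    have h2 : eval v (pderiv 2 quarticCD5) = 2 * v 0 * v 2 * v 3 + 4 * v 2 ^ 3 := by
      simp [quarticCD5, pderiv_X]; ring
    have h3 : eval v (pderiv 3 quarticCD5) = v 0 * v 2 ^ 2 + 4 * v 3 ^ 3 := by
      simp [quarticCD5, pderiv_X]
    have h4 : eval v (pderiv 4 quarticCD5) = 4 * v 4 ^ 3 := by
      simp [quarticCD5, pderiv_X]
    rw [← h0, ← h1, ← h2, ← h3, ← h4]
    rfl
  rw [key]
  constructor
  · rintro ⟨h0, h1, h2, h3, h4⟩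
    have e4 : v 4 = 0 := by simpa using h4
    have e1 : v 1 = 0 := by
      by_contra hb
      have ha2 : v 0 ^ 2 = -2 * v 1 ^ 2 := by
        apply mul_left_cancel₀ hb; linear_combination h1 / 2
      have ha : v 0 ≠ 0 := by
        intro ha
        rw [ha] at ha2
        apply hb
        have : v 1 ^ 2 = 0 := by linear_combination ha2 / 2
        exact pow_eq_zero_iff (two_ne_zero) |>.1 this
      have hcd : v 2 ^ 2 * v 3 ≠ 0 := by
        intro h
        rw [h] at h0
        simp [ha, hb] at h0
      have hc : v 2 ≠ 0 := by rintro h; simp [h] at hcd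
      have hd : v 3 ≠ 0 := by rintro h; simp [h] at hcd
      have h2' : v 0 * v 3 = -2 * v 2 ^ 2 := by
        apply mul_left_cancel₀ hc; linear_combination h2 / 2
      have ha8 : v 0 ^ 2 = 8 * v 3 ^ 2 := by
        apply mul_left_cancel₀ hd; linear_combination v 0 * h2' - 2 * h3
      have : v 0 * v 3 ^ 2 = 0 := by
        linear_combination (-2 / 17 : ℂ) * (h0 - v 0 * ha2 + v 0 * ha8 - v 3 / 2 * h2')
      simp [ha, hd] at this
    have e2 : v 2 = 0 := by
      by_contra hc
      have hd : v 3 = 0 := by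
        rw [e1] at h0
        simpa [hc] using h0
      rw [hd] at h2
      simp [hc] at h2
    have e3 : v 3 = 0 := by
      rw [e2] at h3
      simpa using h3
    have hv' : v = v 0 • (Pi.single (0 : Fin 5) (1 : ℂ) : Fin 5 → ℂ) := by
      funext i
      fin_cases i <;> simp [e1, e2, e3, e4]
    refine ⟨v 0, ?_, hv'⟩
    intro h
    rw [h, zero_smul] at hv'
    exact hv hv'
  · rintro ⟨c, -, rfl⟩
    simp
end

section
/- Let F = x₀²x₁² + x₀x₂³ + x₁⁴ + x₂⁴ + x₃⁴ + x₄⁴ ∈ ℂ[x₀,…,x₄] (the quartic of Example 4.10 with a cE₆ point). Then for every nonzero v ∈ ℂ⁵, all five partial derivatives of F vanish at v if and only if v is a nonzero scalar multiple of e₀ = (1,0,0,0,0); i.e., the quartic hypersurface {F = 0} ⊂ ℙ⁴ has exactly one singular point P = (1:0:0:0:0). -/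
open MvPolynomial

/-- The quartic of Example 4.10 (with a `cE₆` point):
`x₀²x₁² + x₀x₂³ + x₁⁴ + x₂⁴ + x₃⁴ + x₄⁴`. -/
noncomputable def quarticCE6 : MvPolynomial (Fin 5) ℂ :=
  (X 0) ^ 2 * (X 1) ^ 2 + X 0 * (X 2) ^ 3 +
    (X 1) ^ 4 + (X 2) ^ 4 + (X 3) ^ 4 + (X 4) ^ 4

/-- The quartic hypersurface of Example 4.10 with a `cE₆` point has exactly one
singular point `P = (1:0:0:0:0)`: all five partial derivatives vanish at a nonzero
`v ∈ ℂ⁵` iff `v` is a nonzero scalar multiple of `e₀`. -/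
theorem singular_locus_quarticCE6 :
    ∀ v : Fin 5 → ℂ, v ≠ 0 →
      ((∀ k : Fin 5, eval v (pderiv k quarticCE6) = 0) ↔
        ∃ c : ℂ, c ≠ 0 ∧ v = c • (Pi.single (0 : Fin 5) (1 : ℂ) : Fin 5 → ℂ)) := by
  intro v hv
  have key : (∀ k : Fin 5, eval v (pderiv k quarticCE6) = 0) ↔
      (2 * v 0 * v 1 ^ 2 + v 2 ^ 3 = 0 ∧ 2 * v 0 ^ 2 * v 1 + 4 * v 1 ^ 3 = 0 ∧
        3 * v 0 * v 2 ^ 2 + 4 * v 2 ^ 3 = 0 ∧ 4 * v 3 ^ 3 = 0 ∧ 4 * v 4 ^ 3 = 0) := by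
    have e0 : eval v (pderiv 0 quarticCE6) = 2 * v 0 * v 1 ^ 2 + v 2 ^ 3 := by
      simp [quarticCE6, pderiv_X, Pi.single_apply]; try ring
    have e1 : eval v (pderiv 1 quarticCE6) = 2 * v 0 ^ 2 * v 1 + 4 * v 1 ^ 3 := by
      simp [quarticCE6, pderiv_X, Pi.single_apply]; try ring
    have e2 : eval v (pderiv 2 quarticCE6) = 3 * v 0 * v 2 ^ 2 + 4 * v 2 ^ 3 := by
      simp [quarticCE6, pderiv_X, Pi.single_apply]; try ring
    have e3 : eval v (pderiv 3 quarticCE6) = 4 * v 3 ^ 3 := by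
      simp [quarticCE6, pderiv_X, Pi.single_apply]
    have e4 : eval v (pderiv 4 quarticCE6) = 4 * v 4 ^ 3 := by
      simp [quarticCE6, pderiv_X, Pi.single_apply]
    rw [← e0, ← e1, ← e2, ← e3, ← e4]
    constructor
    · intro h
      exact ⟨h 0, h 1, h 2, h 3, h 4⟩
    · rintro ⟨h0, h1, h2, h3, h4⟩ k
      fin_cases k
      exacts [h0, h1, h2, h3, h4]
  rw [key]
  constructor
  · rintro ⟨h0, h1, h2, h3, h4⟩
    have z3 : v 3 = 0 := by simpa using h3
    have z4 : v 4 = 0 := by simpa using h4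
    have z1 : v 1 = 0 := by
      by_contra hb
      have ha2 : v 0 ^ 2 = -2 * v 1 ^ 2 := by
        have h : (2 * v 1) * (v 0 ^ 2 + 2 * v 1 ^ 2) = 0 := by linear_combination h1
        rcases mul_eq_zero.mp h with h | h
        · simp [hb] at h
        · linear_combination h
      have ha : v 0 ≠ 0 := by
        intro ha
        simp [ha, hb] at ha2
      have hc : v 2 ≠ 0 := by
        intro hc
        simp [hc, ha, hb] at h0
      have h2' : 3 * v 0 + 4 * v 2 = 0 := by
        have h : v 2 ^ 2 * (3 * v 0 + 4 * v 2) = 0 := by linear_combination h2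
        exact (mul_eq_zero.mp h).resolve_left (pow_ne_zero 2 hc)
      have c2 : v 2 = -(3 / 4) * v 0 := by linear_combination h2' / 4
      rw [c2] at h0
      have h : v 0 ^ 3 = 0 := by linear_combination (-64 / 91) * h0 + (64 / 91) * v 0 * ha2
      exact ha (by simpa using h)
    have z2 : v 2 = 0 := by simpa [z1] using h0
    have hs : v = v 0 • (Pi.single (0 : Fin 5) (1 : ℂ) : Fin 5 → ℂ) := by
      ext k
      fin_cases k <;> simp [z1, z2, z3, z4]
    refine ⟨v 0, ?_, hs⟩
    intro h
    rw [h, zero_smul] at hs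
    exact hv hs
  · rintro ⟨c, -, rfl⟩
    simp
end

section
/- Let F = (x₀x₁ − x₄²)² + x₀x₂³ + x₂x₃³ + x₁⁴ + x₂⁴ ∈ ℂ[x₀,…,x₄] (the quartic Y of Example 4.10 with a cE₇ point). Then for every nonzero v ∈ ℂ⁵, all five partial derivatives of F vanish at v if and only if v is a nonzero scalar multiple of e₀ = (1,0,0,0,0); i.e., the quartic hypersurface {F = 0} ⊂ ℙ⁴ has exactly one singular point P = (1:0:0:0:0). -/
open MvPolynomial

/-- The quartic `Y` of Example 4.10 (with a `cE₇` point):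
`(x₀x₁ − x₄²)² + x₀x₂³ + x₂x₃³ + x₁⁴ + x₂⁴`. -/
noncomputable def quarticCE7 : MvPolynomial (Fin 5) ℂ :=
  (X 0 * X 1 - (X 4) ^ 2) ^ 2 + X 0 * (X 2) ^ 3 + X 2 * (X 3) ^ 3 +
    (X 1) ^ 4 + (X 2) ^ 4

theorem quartic_aux (a b c d e : ℂ)
    (h0 : 2 * (a * b - e ^ 2) * b + c ^ 3 = 0)
    (h1 : 2 * (a * b - e ^ 2) * a + 4 * b ^ 3 = 0)
    (h2 : 3 * a * c ^ 2 + d ^ 3 + 4 * c ^ 3 = 0)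
    (h3 : 3 * c * d ^ 2 = 0)
    (h4 : (a * b - e ^ 2) * e = 0) : b = 0 ∧ c = 0 ∧ d = 0 ∧ e = 0 := by
  by_cases hc : c = 0
  · subst hc
    have hd : d = 0 := by
      have : d ^ 3 = 0 := by linear_combination h2
      exact pow_eq_zero_iff (by norm_num) |>.mp this
    have hb : b = 0 := by
      have : b ^ 4 = 0 := by linear_combination (b * h1 - a * h0) / 4
      exact pow_eq_zero_iff (by norm_num) |>.mp this
    subst hb
    have he : e = 0 := by
      have : e ^ 3 = 0 := by linear_combination -h4
      exact pow_eq_zero_iff (by norm_num) |>.mp this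
    exact ⟨rfl, rfl, hd, he⟩
  · exfalso
    have hd : d = 0 := by simpa [hc] using h3
    subst hd
    have ha : 3 * a + 4 * c = 0 := by
      have : c ^ 2 * (3 * a + 4 * c) = 0 := by linear_combination h2
      simpa [hc] using this
    have hq : a * b - e ^ 2 ≠ 0 := by
      intro h
      rw [h] at h0
      simp [hc] at h0
    have hb : b ≠ 0 := by
      rintro rfl
      simp [hc] at h0
    have he : e = 0 := by simpa [hq] using h4
    subst he
    have ha' : a = -(4 / 3) * c := by linear_combination ha / 3
    subst ha'
    have e1 : c ^ 2 - 8 / 3 * b ^ 2 = 0 := by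
      have : c * (c ^ 2 - 8 / 3 * b ^ 2) = 0 := by linear_combination h0
      simpa [hc] using this
    have e2 : 16 / 9 * c ^ 2 + 2 * b ^ 2 = 0 := by
      have : b * (16 / 9 * c ^ 2 + 2 * b ^ 2) = 0 := by linear_combination h1 / 2
      exact (mul_eq_zero.mp this).resolve_left hb
    have : c ^ 2 = 0 := by linear_combination (27 / 91 : ℂ) * (e1 + 4 / 3 * e2)
    exact hc (pow_eq_zero_iff (by norm_num) |>.mp this)

/-- The quartic hypersurface `Y` of Example 4.10 with a `cE₇` point has exactly one
singular point `P = (1:0:0:0:0)`: all five partial derivatives vanish at a nonzero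
`v ∈ ℂ⁵` iff `v` is a nonzero scalar multiple of `e₀`. -/
theorem singular_locus_quarticCE7 :
    ∀ v : Fin 5 → ℂ, v ≠ 0 →
      ((∀ k : Fin 5, eval v (pderiv k quarticCE7) = 0) ↔
        ∃ c : ℂ, c ≠ 0 ∧ v = c • (Pi.single (0 : Fin 5) (1 : ℂ) : Fin 5 → ℂ)) := by
  intro v hv
  constructor
  · intro h
    have g0 := h 0
    have g1 := h 1
    have g2 := h 2
    have g3 := h 3
    have g4 := h 4
    simp [quarticCE7, pderiv_X, Pi.single_apply] at g0 g1 g2 g3 g4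
    obtain ⟨hb, hc, hd, he⟩ := quartic_aux (v 0) (v 1) (v 2) (v 3) (v 4)
      (by grind) (by grind) (by grind) (by grind) (by grind)
    have hv' : v = v 0 • (Pi.single (0 : Fin 5) (1 : ℂ) : Fin 5 → ℂ) := by
      ext i
      fin_cases i <;> simp [hb, hc, hd, he]
    refine ⟨v 0, ?_, hv'⟩
    intro h0
    rw [h0, zero_smul] at hv'
    exact hv hv'
  · rintro ⟨c, -, rfl⟩ k
    fin_cases k <;> simp [quarticCE7, pderiv_X, Pi.single_apply]
end
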